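/- arXiv:2003.11186 — 3 statements merged into one kernel-verified Lean document; each statement's English description precedes it below -/
import Mathlib

section
/- Let $1 < p < n$, $0 < \gamma < \infty$ and $-\gamma < q < p-1$. Then for any nonnegative Radon measures $\mu, \sigma$ on $\mathbb{R}^n$, one has the mutual energy estimate $\int_{\mathbb{R}^n} (\mathbf{W}_{1,p}\mu)^{\gamma+q}\, d\sigma \leq C \left(\int_{\mathbb{R}^n} (\mathbf{W}_{1,p}\mu)^{\gamma}\, d\mu\right)^{\frac{\gamma+q}{p-1+\gamma}} \left(\int_{\mathbb{R}^n} (\mathbf{W}_{1,p}\sigma)^{\frac{(\gamma+q)(p-1)}{p-1-q}}\, d\sigma\right)^{\frac{p-1-q}{p-1+\gamma}}$, where $C = C(n,p,\gamma,q)$. -/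
open MeasureTheory Metric ENNReal

/-- The Wolff potential `W_{1,p}σ(x) = ∫₀^∞ (σ(B(x,r))/r^{n-p})^{1/(p-1)} dr/r`. -/
noncomputable def wolff (n : ℕ) (p : ℝ) (σ : Measure (EuclideanSpace ℝ (Fin n)))
    (x : EuclideanSpace ℝ (Fin n)) : ℝ≥0∞ :=
  ∫⁻ r in Set.Ioi (0 : ℝ),
    (σ (ball x r) / ENNReal.ofReal (r ^ ((n : ℝ) - p))) ^ (1 / (p - 1)) / ENNReal.ofReal r

lemma rpow_anti_aux {x y : ℝ≥0∞} {z : ℝ} (h : x ≤ y) (hz : z ≤ 0) : y ^ z ≤ x ^ z := by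
  obtain ⟨w, rfl⟩ : ∃ w, z = -w := ⟨-z, by ring⟩
  rw [ENNReal.rpow_neg, ENNReal.rpow_neg]
  exact ENNReal.inv_le_inv.2 (ENNReal.rpow_le_rpow h (by linarith))

lemma tail_level (ν : Measure ℝ) [NullSingletonClass ν] (l : ℝ≥0∞) :
    ν {r | ν (Set.Ioi r) ≤ l} ≤ l := by
  set S : Set ℝ := {r | ν (Set.Ioi r) ≤ l} with hS
  have up : ∀ {a b : ℝ}, a ∈ S → a ≤ b → b ∈ S := fun {a b} ha hab =>
    (measure_mono (Set.Ioi_subset_Ioi hab)).trans ha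
  by_cases h : ∃ r0 ∈ S, ∀ r ∈ S, r0 ≤ r
  · obtain ⟨r0, h0, h1⟩ := h
    calc ν S ≤ ν (Set.Ici r0) := measure_mono h1
      _ = ν (Set.Ioi r0) := (measure_congr Ioi_ae_eq_Ici).symm
      _ ≤ l := h0
  · push Not at h
    have hsub : S ⊆ ⋃ q : {q : ℚ // (q : ℝ) ∈ S}, Set.Ioi ((q : ℚ) : ℝ) := by
      intro x hx
      obtain ⟨r, hr, hrx⟩ := h x hx
      obtain ⟨q, hq1, hq2⟩ := exists_rat_btwn hrx
      exact Set.mem_iUnion.2 ⟨⟨q, up hr hq1.le⟩, hq2⟩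
    refine (measure_mono hsub).trans ?_
    rw [Directed.measure_iUnion]
    · exact iSup_le fun q => q.2
    · intro a b
      rcases le_total (a : ℚ) b with h | h
      · exact ⟨a, subset_rfl, Set.Ioi_subset_Ioi (by exact_mod_cast h)⟩
      · exact ⟨b, Set.Ioi_subset_Ioi (by exact_mod_cast h), subset_rfl⟩

lemma tail_meas (ν : Measure ℝ) : Measurable fun r => ν (Set.Ioi r) :=
  Antitone.measurable fun _ _ h => measure_mono (Set.Ioi_subset_Ioi h)

lemma tail_upper (γ : ℝ) (hγ : 0 < γ) : ∃ C : ℝ≥0∞, C ≠ ⊤ ∧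
    ∀ (ν : Measure ℝ) [NullSingletonClass ν],
      ∫⁻ r, (ν (Set.Ioi r)) ^ (γ - 1) ∂ν ≤ C * (ν Set.univ) ^ γ := by
  by_cases h1 : 1 ≤ γ
  · refine ⟨1, by simp, fun ν _ => ?_⟩
    calc ∫⁻ r, (ν (Set.Ioi r)) ^ (γ - 1) ∂ν ≤ ∫⁻ r, (ν Set.univ) ^ (γ - 1) ∂ν :=
          lintegral_mono fun r => ENNReal.rpow_le_rpow (measure_mono (Set.subset_univ _)) (by linarith)
      _ = (ν Set.univ) ^ (γ - 1) * (ν Set.univ) ^ (1 : ℝ) := by simp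
      _ = 1 * (ν Set.univ) ^ γ := by
          rw [← ENNReal.rpow_add_of_nonneg _ _ (by linarith) (by linarith)]; simp
  push Not at h1
  have hq : (2⁻¹ : ℝ≥0∞) ^ γ < 1 := ENNReal.rpow_lt_one (by simp) hγ
  refine ⟨(2⁻¹ : ℝ≥0∞) ^ (γ - 1) * (1 - (2⁻¹ : ℝ≥0∞) ^ γ)⁻¹, ?_, fun ν _ => ?_⟩
  · refine ENNReal.mul_ne_top (ENNReal.rpow_ne_top_of_ne_zero (by simp) (by simp)) ?_
    simp [tsub_eq_zero_iff_le, hq]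
  set M := ν Set.univ with hM
  set C : ℝ≥0∞ := (2⁻¹ : ℝ≥0∞) ^ (γ - 1) * (1 - (2⁻¹ : ℝ≥0∞) ^ γ)⁻¹ with hC
  have hC0 : C ≠ 0 := by
    refine mul_ne_zero (ENNReal.rpow_pos (by simp) (by simp)).ne' ?_
    rw [Ne, ENNReal.inv_eq_zero]
    exact ne_top_of_le_ne_top one_ne_top tsub_le_self
  by_cases hMt : M = ⊤
  · rw [hMt, ENNReal.top_rpow_of_pos hγ, ENNReal.mul_top hC0]; exact le_top
  by_cases hM0 : M = 0
  · have : ν = 0 := Measure.measure_univ_eq_zero.1 hM0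
    subst this; simp
  have h0 : ∀ᵐ r ∂ν, ν (Set.Ioi r) ≠ 0 := by
    rw [ae_iff]
    have := tail_level ν 0
    simpa using this
  have hpt : ∀ᵐ r ∂ν, (ν (Set.Ioi r)) ^ (γ - 1) ≤ ∑' k : ℕ,
      Set.indicator {r | ν (Set.Ioi r) ≤ M * 2⁻¹ ^ k} (fun _ => (M * 2⁻¹ ^ (k + 1)) ^ (γ - 1)) r := by
    filter_upwards [h0] with r hr
    have hle : ν (Set.Ioi r) ≤ M := measure_mono (Set.subset_univ _)
    have hFt : ν (Set.Ioi r) ≠ ⊤ := ne_top_of_le_ne_top hMt hle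
    have hMp : 0 < M.toReal := ENNReal.toReal_pos hM0 hMt
    obtain ⟨k, hk1, hk2⟩ := exists_nat_pow_near_of_lt_one (K := ℝ)
      (x := (ν (Set.Ioi r)).toReal / M.toReal) (y := 2⁻¹)
      (div_pos (ENNReal.toReal_pos hr hFt) hMp)
      ((div_le_one hMp).2 (ENNReal.toReal_mono hMt hle)) (by norm_num) (by norm_num)
    rw [lt_div_iff₀ hMp] at hk1
    rw [div_le_iff₀ hMp] at hk2
    have e : ∀ j : ℕ, M * 2⁻¹ ^ j ≠ ⊤ := fun j => ENNReal.mul_ne_top hMt (by simp)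
    have e' : ∀ j : ℕ, (M * 2⁻¹ ^ j).toReal = 2⁻¹ ^ j * M.toReal := fun j => by
      rw [ENNReal.toReal_mul, mul_comm]; simp
    have g1 : M * 2⁻¹ ^ (k + 1) ≤ ν (Set.Ioi r) := by
      rw [← ENNReal.toReal_le_toReal (e _) hFt, e']; exact hk1.le
    have g2 : ν (Set.Ioi r) ≤ M * 2⁻¹ ^ k := by
      rw [← ENNReal.toReal_le_toReal hFt (e _), e']; exact hk2
    refine le_trans ?_ (ENNReal.le_tsum k)
    rw [Set.indicator_of_mem (by exact g2)]
    exact rpow_anti_aux g1 (by linarith)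
  refine (lintegral_mono_ae hpt).trans ?_
  rw [lintegral_tsum]
  swap
  · intro k
    exact (Measurable.indicator measurable_const
      (measurableSet_le (tail_meas ν) measurable_const)).aemeasurable
  have hterm : ∀ k : ℕ, ∫⁻ r, Set.indicator {r | ν (Set.Ioi r) ≤ M * 2⁻¹ ^ k}
      (fun _ => (M * 2⁻¹ ^ (k + 1)) ^ (γ - 1)) r ∂ν ≤
      (2⁻¹ : ℝ≥0∞) ^ (γ - 1) * M ^ γ * ((2⁻¹ : ℝ≥0∞) ^ γ) ^ k := by
    intro k
    rw [lintegral_indicator_const (measurableSet_le (tail_meas ν) measurable_const)]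
    refine (mul_le_mul_right (tail_level ν _) _).trans ?_
    have hx0 : M * 2⁻¹ ^ k ≠ 0 := mul_ne_zero hM0 (by simp)
    have hxt : M * 2⁻¹ ^ k ≠ ⊤ := ENNReal.mul_ne_top hMt (by simp)
    have : M * 2⁻¹ ^ (k + 1) = 2⁻¹ * (M * 2⁻¹ ^ k) := by ring
    rw [this, ENNReal.mul_rpow_of_ne_top (by simp) hxt, mul_assoc]
    nth_rewrite 2 [← ENNReal.rpow_one (M * 2⁻¹ ^ k)]
    rw [← ENNReal.rpow_add _ _ hx0 hxt, sub_add_cancel, ENNReal.mul_rpow_of_nonneg _ _ hγ.le,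
      mul_assoc]
    rw [← ENNReal.rpow_natCast, ← ENNReal.rpow_mul, mul_comm (k : ℝ), ENNReal.rpow_mul,
      ENNReal.rpow_natCast]
  refine (ENNReal.tsum_le_tsum hterm).trans ?_
  rw [ENNReal.tsum_mul_left, ENNReal.tsum_geometric, hC]
  exact le_of_eq (by ring)

lemma tail_lower (β : ℝ) (hβ : 0 < β) : ∃ C : ℝ≥0∞, C ≠ ⊤ ∧
    ∀ (ν : Measure ℝ) [NullSingletonClass ν], (∀ r, 0 < r → ν (Set.Ioi r) ≠ ⊤) →
      (ν (Set.Ioi 0)) ^ β ≤ C * ∫⁻ r, (ν (Set.Ioi r)) ^ (β - 1) ∂ν := by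
  have hC1 : (1 : ℝ≥0∞) ≤ 2 ^ β := ENNReal.one_le_rpow (by norm_num) hβ
  refine ⟨2 ^ β, by simp, fun ν _ hfin => ?_⟩
  have key : ∀ ε : ℝ, 0 < ε →
      (ν (Set.Ioi ε)) ^ β ≤ 2 ^ β * ∫⁻ r, (ν (Set.Ioi r)) ^ (β - 1) ∂ν := by
    intro ε hε
    set M := ν (Set.Ioi ε) with hM
    have hMt : M ≠ ⊤ := hfin ε hε
    by_cases hM0 : M = 0
    · rw [hM0, ENNReal.zero_rpow_of_pos hβ]; exact zero_le
    by_cases h1 : β ≤ 1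
    · calc M ^ β = M ^ (β - 1) * M ^ (1 : ℝ) := by
            rw [← ENNReal.rpow_add _ _ hM0 hMt, sub_add_cancel]
        _ = ∫⁻ r in Set.Ioi ε, M ^ (β - 1) ∂ν := by simp [hM]
        _ ≤ ∫⁻ r in Set.Ioi ε, (ν (Set.Ioi r)) ^ (β - 1) ∂ν := by
            refine setLIntegral_mono' measurableSet_Ioi fun r hr => ?_
            exact rpow_anti_aux (measure_mono (Set.Ioi_subset_Ioi (le_of_lt hr))) (by linarith)
        _ ≤ ∫⁻ r, (ν (Set.Ioi r)) ^ (β - 1) ∂ν := setLIntegral_le_lintegral _ _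
        _ ≤ _ := le_mul_of_one_le_left zero_le hC1
    · push Not at h1
      set T : Set ℝ := {r | M / 2 < ν (Set.Ioi r)} with hT
      have hTm : MeasurableSet T := measurableSet_lt measurable_const (tail_meas ν)
      have hTM : M / 2 ≤ ν T := by
        have : M ≤ ν T + M / 2 := by
          calc M ≤ ν (T ∪ {r | ν (Set.Ioi r) ≤ M / 2}) := by
                refine measure_mono fun r _ => ?_
                exact (lt_or_ge (M / 2) (ν (Set.Ioi r)))
            _ ≤ ν T + ν {r | ν (Set.Ioi r) ≤ M / 2} := measure_union_le _ _
            _ ≤ ν T + M / 2 := by gcongr; exact tail_level ν _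
        have h2 : M / 2 + M / 2 ≤ ν T + M / 2 := by rwa [ENNReal.add_halves]
        exact (ENNReal.add_le_add_iff_right (ENNReal.div_ne_top hMt (by simp))).1 h2
      have hh0 : M / 2 ≠ 0 := by simp [hM0]
      have hht : M / 2 ≠ ⊤ := ENNReal.div_ne_top hMt (by simp)
      calc M ^ β = (2 * (M / 2)) ^ β := by rw [ENNReal.mul_div_cancel (by simp) (by simp)]
        _ = 2 ^ β * ((M / 2) ^ (β - 1) * (M / 2) ^ (1 : ℝ)) := by
            rw [← ENNReal.rpow_add _ _ hh0 hht, sub_add_cancel, ENNReal.mul_rpow_of_nonneg _ _ hβ.le]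
        _ ≤ 2 ^ β * ((M / 2) ^ (β - 1) * ν T) := by rw [ENNReal.rpow_one]; gcongr
        _ = 2 ^ β * ∫⁻ r in T, (M / 2) ^ (β - 1) ∂ν := by simp
        _ ≤ 2 ^ β * ∫⁻ r in T, (ν (Set.Ioi r)) ^ (β - 1) ∂ν := by
            gcongr 2 ^ β * ?_
            refine setLIntegral_mono' hTm fun r hr => ?_
            exact ENNReal.rpow_le_rpow (le_of_lt hr) (by linarith)
        _ ≤ _ := by gcongr; exact Measure.restrict_le_self
  have hun : Set.Ioi (0 : ℝ) = ⋃ k : ℕ, Set.Ioi (1 / ((k : ℝ) + 1)) := by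
    ext x
    simp only [Set.mem_Ioi, Set.mem_iUnion]
    exact ⟨fun h => exists_nat_one_div_lt h, fun ⟨k, hk⟩ => lt_trans (by positivity) hk⟩
  have hmono : Monotone fun k : ℕ => Set.Ioi (1 / ((k : ℝ) + 1)) := fun a b hab =>
    Set.Ioi_subset_Ioi (one_div_le_one_div_of_le (by positivity) (by gcongr))
  rw [hun, hmono.measure_iUnion]
  have := (ENNReal.orderIsoRpow β hβ).map_iSup fun k : ℕ => ν (Set.Ioi (1 / ((k : ℝ) + 1)))
  simp only [ENNReal.orderIsoRpow_apply] at this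
  rw [this]
  exact iSup_le fun k => key _ (by positivity)

/-- The measure `dr/r` on the positive half-line. -/
noncomputable def tau : Measure ℝ :=
  (volume.restrict (Set.Ioi (0 : ℝ))).withDensity fun r => (ENNReal.ofReal r)⁻¹

instance tau_sfinite : SFinite tau := by unfold tau; infer_instance

instance tau_null : NullSingletonClass tau := nullSingletonClass_withDensity _

lemma lintegral_tau (h : ℝ → ℝ≥0∞) (hh : Measurable h) :
    ∫⁻ r, h r ∂tau = ∫⁻ r in Set.Ioi (0 : ℝ), h r / ENNReal.ofReal r := by
  unfold tau
  rw [lintegral_withDensity_eq_lintegral_mul _ (by fun_prop) hh]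
  refine lintegral_congr fun r => ?_
  simp [div_eq_mul_inv, mul_comm]

lemma ae_tau_pos : ∀ᵐ r ∂tau, 0 < r :=
  (withDensity_absolutelyContinuous _ _).ae_le (ae_restrict_mem measurableSet_Ioi)

lemma tau_scale (h : ℝ → ℝ≥0∞) (hh : Measurable h) :
    ∫⁻ r, h (2 * r) ∂tau = ∫⁻ r, h r ∂tau := by
  rw [lintegral_tau _ hh, lintegral_tau (fun r => h (2 * r)) (hh.comp (measurable_const_mul 2))]
  rw [← lintegral_indicator measurableSet_Ioi, ← lintegral_indicator measurableSet_Ioi]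
  set k : ℝ → ℝ≥0∞ := (Set.Ioi (0 : ℝ)).indicator fun r => h r / ENNReal.ofReal r with hk
  have hkm : Measurable k := Measurable.indicator (by fun_prop) measurableSet_Ioi
  have h1 : ∀ r, (Set.Ioi (0 : ℝ)).indicator (fun r => h (2 * r) / ENNReal.ofReal r) r
      = 2 * k (2 * r) := by
    intro r
    by_cases hr : 0 < r
    · rw [Set.indicator_of_mem (by exact hr), hk, Set.indicator_of_mem (by simpa using hr),
        ENNReal.ofReal_mul (by norm_num), div_eq_mul_inv, div_eq_mul_inv,
        ENNReal.mul_inv (by simp) (by simp), mul_left_comm, ← mul_assoc 2]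
      simp [ENNReal.mul_inv_cancel]
    · rw [Set.indicator_of_notMem (by exact hr), hk, Set.indicator_of_notMem (by simpa using hr),
        mul_zero]
  simp_rw [h1]
  rw [lintegral_const_mul _ (by fun_prop)]
  have h2 : ∫⁻ r, k (2 * r) = ∫⁻ r, k r ∂(Measure.map (fun x : ℝ => 2 * x) volume) :=
    (lintegral_map hkm (by fun_prop)).symm
  rw [h2, Real.map_volume_mul_left two_ne_zero, lintegral_smul_measure, smul_eq_mul, ← mul_assoc]
  have : (2 : ℝ≥0∞) * ENNReal.ofReal |2⁻¹| = 1 := by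
    rw [← ENNReal.ofReal_ofNat 2, ← ENNReal.ofReal_mul (by norm_num)]
    norm_num
  rw [this, one_mul]

lemma tau_Ioi_pos {R : ℝ} (hR : 0 ≤ R) : 0 < tau (Set.Ioi R) := by
  unfold tau
  rw [withDensity_apply _ measurableSet_Ioi, Measure.restrict_restrict measurableSet_Ioi,
    Set.inter_eq_left.2 (Set.Ioi_subset_Ioi hR), setLIntegral_pos_iff (by fun_prop)]
  have : (Function.support fun r : ℝ => (ENNReal.ofReal r)⁻¹) ∩ Set.Ioi R = Set.Ioi R := by
    refine Set.inter_eq_right.2 fun r _ => ?_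
    simp
  rw [this]; simp

lemma tau_Ioc_lt {r R : ℝ} (hr : 0 < r) : tau (Set.Ioc r R) < ⊤ := by
  unfold tau
  rw [withDensity_apply _ measurableSet_Ioc, Measure.restrict_restrict measurableSet_Ioc]
  calc ∫⁻ a in Set.Ioc r R ∩ Set.Ioi 0, (ENNReal.ofReal a)⁻¹
      ≤ ∫⁻ a in Set.Ioc r R ∩ Set.Ioi 0, (ENNReal.ofReal r)⁻¹ := by
        refine setLIntegral_mono' (measurableSet_Ioc.inter measurableSet_Ioi) fun a ha => ?_
        exact ENNReal.inv_le_inv.2 (ENNReal.ofReal_le_ofReal ha.1.1.le)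
    _ = (ENNReal.ofReal r)⁻¹ * volume (Set.Ioc r R ∩ Set.Ioi 0) := by simp
    _ < ⊤ := by
        refine ENNReal.mul_lt_top (by simpa using hr) ?_
        exact (measure_mono Set.inter_subset_left).trans_lt (by simp)

section

variable {n : ℕ} {p : ℝ}

local notation "E" => EuclideanSpace ℝ (Fin n)

/-- The integrand of the Wolff potential. -/
noncomputable def wf (n : ℕ) (p : ℝ) (σ : Measure (EuclideanSpace ℝ (Fin n)))
    (x : EuclideanSpace ℝ (Fin n)) (r : ℝ) : ℝ≥0∞ :=
  (σ (ball x r) / ENNReal.ofReal (r ^ ((n : ℝ) - p))) ^ (1 / (p - 1))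

/-- The tail of the Wolff potential. -/
noncomputable def wF (n : ℕ) (p : ℝ) (σ : Measure (EuclideanSpace ℝ (Fin n)))
    (x : EuclideanSpace ℝ (Fin n)) (r : ℝ) : ℝ≥0∞ :=
  ∫⁻ s in Set.Ioi r, wf n p σ x s ∂tau

lemma wf_meas (μ : Measure E) (x : E) : Measurable (wf n p μ x) := by
  have : Measurable fun r => μ (ball x r) :=
    Monotone.measurable fun _ _ h => measure_mono (ball_subset_ball h)
  unfold wf
  exact (this.div (by fun_prop)).pow_const _

lemma wolff_eq (μ : Measure E) (x : E) : wolff n p μ x = ∫⁻ r, wf n p μ x r ∂tau := by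
  rw [lintegral_tau _ (wf_meas μ x)]; rfl

lemma wF_le_wolff (μ : Measure E) (x : E) (r : ℝ) : wF n p μ x r ≤ wolff n p μ x := by
  rw [wolff_eq]; exact setLIntegral_le_lintegral _ _

lemma wF_anti (μ : Measure E) (x : E) {r s : ℝ} (h : r ≤ s) : wF n p μ x s ≤ wF n p μ x r :=
  lintegral_mono_set (Set.Ioi_subset_Ioi h)

/-- The comparison constant. -/
noncomputable def wK (n : ℕ) (p : ℝ) : ℝ≥0∞ := ENNReal.ofReal (2 ^ ((n : ℝ) - p)) ^ (1 / (p - 1))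

lemma wK_ne_top (hp : 1 < p) : wK n p ≠ ⊤ :=
  ENNReal.rpow_ne_top_of_nonneg (by have : 0 < p - 1 := by linarith
                                    positivity) (by simp)

lemma wK_ne_zero : wK n p ≠ 0 :=
  (ENNReal.rpow_pos (by rw [ENNReal.ofReal_pos]; positivity) (by simp)).ne'

lemma wf_le (hp : 1 < p) (μ : Measure E) {x y : E} {r : ℝ} (hr : 0 < r) (h : dist x y ≤ r) :
    wf n p μ x r ≤ wK n p * wf n p μ y (2 * r) := by
  have hs : 0 ≤ 1 / (p - 1) := by
    have : 0 < p - 1 := by linarith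
    positivity
  unfold wf wK
  rw [← ENNReal.mul_rpow_of_nonneg _ _ hs]
  refine ENNReal.rpow_le_rpow ?_ hs
  rw [Real.mul_rpow (by norm_num) hr.le, ENNReal.ofReal_mul (by positivity), div_eq_mul_inv,
    div_eq_mul_inv, ENNReal.mul_inv (by simp) (by simp)]
  have h2 : ENNReal.ofReal (2 ^ ((n : ℝ) - p)) ≠ 0 := by
    rw [Ne, ENNReal.ofReal_eq_zero, not_le]; positivity
  have hb : ball x r ⊆ ball y (2 * r) := ball_subset_ball' (by linarith)
  calc μ (ball x r) * (ENNReal.ofReal (r ^ ((n : ℝ) - p)))⁻¹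
      ≤ μ (ball y (2 * r)) * (ENNReal.ofReal (r ^ ((n : ℝ) - p)))⁻¹ := by gcongr
    _ = (ENNReal.ofReal (2 ^ ((n : ℝ) - p)) * (ENNReal.ofReal (2 ^ ((n : ℝ) - p)))⁻¹) *
        (μ (ball y (2 * r)) * (ENNReal.ofReal (r ^ ((n : ℝ) - p)))⁻¹) := by
        rw [ENNReal.mul_inv_cancel h2 (by simp), one_mul]
    _ = _ := by ring

lemma wF_le (hp : 1 < p) (μ : Measure E) {x y : E} {r : ℝ} (hr : 0 < r) (h : dist x y ≤ r) :
    wF n p μ x r ≤ wK n p * wF n p μ y (2 * r) := by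
  unfold wF
  calc ∫⁻ s in Set.Ioi r, wf n p μ x s ∂tau
      ≤ ∫⁻ s in Set.Ioi r, wK n p * wf n p μ y (2 * s) ∂tau := by
        refine setLIntegral_mono' measurableSet_Ioi fun s hs => ?_
        exact wf_le hp μ (hr.trans hs) (h.trans (le_of_lt hs))
    _ = wK n p * ∫⁻ s in Set.Ioi r, wf n p μ y (2 * s) ∂tau :=
        lintegral_const_mul _ ((wf_meas μ y).comp (measurable_const_mul 2))
    _ = wK n p * ∫⁻ s, (Set.Ioi (2 * r)).indicator (wf n p μ y) (2 * s) ∂tau := by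
        rw [← lintegral_indicator measurableSet_Ioi]
        congr 1
        refine lintegral_congr fun s => ?_
        simp [Set.indicator]
    _ = _ := by
        rw [tau_scale _ ((wf_meas μ y).indicator measurableSet_Ioi),
          lintegral_indicator measurableSet_Ioi]

lemma wf_top (hp : 1 < p) (μ : Measure E) {x : E} {r s : ℝ} (h : μ (ball x r) = ⊤) (hrs : r ≤ s) :
    wf n p μ x s = ⊤ := by
  have : μ (ball x s) = ⊤ := top_unique (h ▸ measure_mono (ball_subset_ball hrs))
  unfold wf
  rw [this, ENNReal.top_div_of_ne_top (by simp), ENNReal.top_rpow_of_pos]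
  have : 0 < p - 1 := by linarith
  positivity

lemma wF_top (hp : 1 < p) (μ : Measure E) {x : E} {r : ℝ} (hr : 0 ≤ r) (h : μ (ball x r) = ⊤) :
    wF n p μ x r = ⊤ := by
  unfold wF
  rw [setLIntegral_congr_fun (g := fun _ => ⊤) measurableSet_Ioi
    (fun s hs => wf_top hp μ h (le_of_lt hs))]
  simp [ENNReal.top_mul, (tau_Ioi_pos hr).ne']

lemma wolff_dich (hp : 1 < p) (hpn : p < n) (μ : Measure E) :
    (∀ y, wolff n p μ y = ⊤) ∨ ∀ x r, 0 < r → wF n p μ x r ≠ ⊤ := by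
  by_contra! hcon
  obtain ⟨⟨y, hy⟩, x, r, hr, hxr⟩ := hcon
  apply hy
  set R := max r (dist x y)
  have hR : 0 < R := lt_max_of_lt_left hr
  have hs : 0 ≤ 1 / (p - 1) := by
    have : 0 < p - 1 := by linarith
    positivity
  have hFR : wF n p μ x R = ⊤ := by
    by_cases hb : μ (ball x R) = ⊤
    · exact wF_top hp μ hR.le hb
    have h1 : wF n p μ x r ≤ (∫⁻ s in Set.Ioc r R, wf n p μ x s ∂tau) + wF n p μ x R := by
      unfold wF
      rw [← Set.Ioc_union_Ioi_eq_Ioi (le_max_left r (dist x y))]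
      exact lintegral_union_le _ _ _
    have h2 : ∫⁻ s in Set.Ioc r R, wf n p μ x s ∂tau ≤
        (μ (ball x R) / ENNReal.ofReal (r ^ ((n : ℝ) - p))) ^ (1 / (p - 1)) * tau (Set.Ioc r R) := by
      rw [← setLIntegral_const]
      refine setLIntegral_mono' measurableSet_Ioc fun s hs' => ?_
      refine ENNReal.rpow_le_rpow ?_ hs
      refine ENNReal.div_le_div (measure_mono (ball_subset_ball hs'.2)) ?_
      exact ENNReal.ofReal_le_ofReal (Real.rpow_le_rpow hr.le hs'.1.le (by linarith))
    have h3 : ∫⁻ s in Set.Ioc r R, wf n p μ x s ∂tau ≠ ⊤ := by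
      refine ne_top_of_le_ne_top (ENNReal.mul_ne_top ?_ (tau_Ioc_lt hr).ne) h2
      refine ENNReal.rpow_ne_top_of_nonneg hs (ENNReal.div_ne_top hb ?_)
      rw [Ne, ENNReal.ofReal_eq_zero, not_le]; positivity
    rw [hxr, top_le_iff, ENNReal.add_eq_top] at h1
    exact h1.resolve_left h3
  have h4 := (wF_le hp μ hR (le_max_right r (dist x y))).trans
    (mul_le_mul_right (wF_le_wolff μ y (2 * R)) _)
  rw [hFR, top_le_iff, ENNReal.mul_eq_top] at h4
  rcases h4 with h | h
  · exact h.2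
  · exact absurd h.1 (wK_ne_top hp)

lemma wF_ne_zero (hp : 1 < p) (μ : Measure E) (hμ : μ ≠ 0) (x : E) (r : ℝ) :
    wF n p μ x r ≠ 0 := by
  obtain ⟨k, hk⟩ : ∃ k : ℕ, 0 < μ (ball x k) := by
    by_contra! h
    apply hμ
    rw [← Measure.measure_univ_eq_zero, ← iUnion_ball_nat x]
    exact measure_iUnion_null fun k => le_zero_iff.1 (h k)
  set R : ℝ := max (k : ℝ) r
  have hR : 0 ≤ R := le_max_of_le_left (by positivity)
  have h1 : 0 < wF n p μ x R := by
    unfold wF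
    rw [setLIntegral_pos_iff (wf_meas μ x)]
    have : Function.support (wf n p μ x) ∩ Set.Ioi R = Set.Ioi R := by
      refine Set.inter_eq_right.2 fun s hs => ?_
      have : 0 < μ (ball x s) := hk.trans_le
        (measure_mono (ball_subset_ball ((le_max_left _ _).trans (le_of_lt hs))))
      rw [Function.mem_support]
      unfold wf
      have h0 : 0 < p - 1 := by linarith
      rw [Ne, ENNReal.rpow_eq_zero_iff_of_pos (by positivity)]
      exact (ENNReal.div_pos this.ne' (by simp)).ne'
    rw [this]
    exact tau_Ioi_pos hR
  exact (h1.trans_le (wF_anti μ x (le_max_right _ _))).ne'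

lemma ball_ne_top (hp : 1 < p) (μ : Measure E) (h : ∀ x r, 0 < r → wF n p μ x r ≠ ⊤) (x : E)
    (r : ℝ) (hr : 0 < r) : μ (ball x r) ≠ ⊤ := fun h' => h x r hr (wF_top hp μ hr.le h')

lemma sfin_aux (hp : 1 < p) (μ : Measure E) (h : ∀ x r, 0 < r → wF n p μ x r ≠ ⊤) :
    SFinite μ := by
  have : IsLocallyFiniteMeasure μ :=
    ⟨fun x => ⟨ball x 1, ball_mem_nhds x one_pos, (ball_ne_top hp μ h x 1 one_pos).lt_top⟩⟩
  infer_instance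

lemma ball_meas (μ : Measure E) [SFinite μ] : Measurable fun z : E × ℝ => μ (ball z.1 z.2) := by
  have hs : MeasurableSet {w : (E × ℝ) × E | dist w.2 w.1.1 < w.1.2} :=
    measurableSet_lt (by fun_prop) (by fun_prop)
  exact measurable_measure_prodMk_left hs

lemma wf_meas2 (μ : Measure E) [SFinite μ] : Measurable fun z : E × ℝ => wf n p μ z.1 z.2 := by
  have := ball_meas μ
  unfold wf
  exact (this.div (by fun_prop)).pow_const _

lemma wF_meas2 (μ : Measure E) [SFinite μ] : Measurable fun z : E × ℝ => wF n p μ z.1 z.2 := by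
  unfold wF
  simp_rw [← lintegral_indicator measurableSet_Ioi]
  have h : Measurable fun w : (E × ℝ) × ℝ =>
      (Set.Ioi w.1.2).indicator (wf n p μ w.1.1) w.2 := by
    have h1 : Measurable fun w : (E × ℝ) × ℝ => wf n p μ w.1.1 w.2 :=
      (wf_meas2 μ).comp (f := fun w : (E × ℝ) × ℝ => (w.1.1, w.2)) (by fun_prop)
    exact h1.indicator (s := {w : (E × ℝ) × ℝ | w.1.2 < w.2})
      (measurableSet_lt (by fun_prop) (by fun_prop))
  exact h.lintegral_prod_right'

lemma wolff_meas (μ : Measure E) [SFinite μ] : Measurable (wolff n p μ) := by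
  have : wolff n p μ = fun x => ∫⁻ r, wf n p μ x r ∂tau := funext (wolff_eq μ)
  rw [this]
  exact (wf_meas2 μ).lintegral_prod_right'

lemma energy_ne_zero (hp : 1 < p) (hpn : p < n) (μ : Measure E) (hμ : μ ≠ 0) (e : ℝ) (he : 0 < e) :
    ∫⁻ x, wolff n p μ x ^ e ∂μ ≠ 0 := by
  rcases wolff_dich hp hpn μ with h | h
  · simp [h, ENNReal.top_rpow_of_pos he, hμ]
  have := sfin_aux hp μ h
  rw [Ne, lintegral_eq_zero_iff ((wolff_meas μ).pow_const e)]
  intro hz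
  apply hμ
  have hne : ∀ x, wolff n p μ x ^ e ≠ 0 := fun x => by
    rw [Ne, ENNReal.rpow_eq_zero_iff_of_pos he]
    exact ((wF_ne_zero hp μ hμ x 0).bot_lt.trans_le (wF_le_wolff μ x 0)).ne'
  rw [← Measure.measure_univ_eq_zero]
  have h2 : μ {x | ¬ (wolff n p μ x ^ e = (0 : E → ℝ≥0∞) x)} = 0 := hz
  convert h2
  exact (Set.eq_univ_of_forall fun x => hne x).symm

lemma cover_aux (n : ℕ) : ∃ N : ℕ, ∀ (σ : Measure (EuclideanSpace ℝ (Fin n)))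
    (y : EuclideanSpace ℝ (Fin n)) (r : ℝ), 0 < r →
    ∫⁻ x in ball y r, (σ (ball x r))⁻¹ ∂σ ≤ N := by
  obtain ⟨t, -, ht, hcov⟩ := (isCompact_closedBall (0 : EuclideanSpace ℝ (Fin n)) 1).finite_cover_balls
    (show (0 : ℝ) < 1 / 2 by norm_num)
  have := ht.fintype
  refine ⟨Fintype.card t, fun σ y r hr => ?_⟩
  have hsub : ball y r ⊆ ⋃ c : t, ball (y + r • (c : EuclideanSpace ℝ (Fin n))) (r / 2) := by
    intro x hx
    have h1 : r⁻¹ • (x - y) ∈ closedBall (0 : EuclideanSpace ℝ (Fin n)) 1 := by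
      rw [mem_closedBall_zero_iff, norm_smul, norm_inv, Real.norm_of_nonneg hr.le, inv_mul_le_iff₀ hr]
      rw [mem_ball, dist_eq_norm] at hx
      linarith
    obtain ⟨c, hc, hxc⟩ := Set.mem_iUnion₂.1 (hcov h1)
    refine Set.mem_iUnion.2 ⟨⟨c, hc⟩, ?_⟩
    rw [mem_ball, dist_eq_norm] at hxc ⊢
    have : x - (y + r • c) = r • (r⁻¹ • (x - y) - c) := by
      rw [smul_sub, smul_inv_smul₀ hr.ne']; abel
    rw [this, norm_smul, Real.norm_of_nonneg hr.le]
    nlinarith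
  calc ∫⁻ x in ball y r, (σ (ball x r))⁻¹ ∂σ
      ≤ ∫⁻ x in ⋃ c : t, ball (y + r • (c : EuclideanSpace ℝ (Fin n))) (r / 2), (σ (ball x r))⁻¹ ∂σ :=
        lintegral_mono_set hsub
    _ ≤ ∑' c : t, ∫⁻ x in ball (y + r • (c : EuclideanSpace ℝ (Fin n))) (r / 2),
          (σ (ball x r))⁻¹ ∂σ := lintegral_iUnion_le _ _
    _ ≤ ∑' c : t, (1 : ℝ≥0∞) := by
        refine ENNReal.tsum_le_tsum fun c => ?_
        set z := y + r • (c : EuclideanSpace ℝ (Fin n))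
        calc ∫⁻ x in ball z (r / 2), (σ (ball x r))⁻¹ ∂σ
            ≤ ∫⁻ x in ball z (r / 2), (σ (ball z (r / 2)))⁻¹ ∂σ := by
              refine setLIntegral_mono' measurableSet_ball fun x hx => ?_
              refine ENNReal.inv_le_inv.2 (measure_mono (ball_subset_ball' ?_))
              rw [mem_ball, dist_comm] at hx
              linarith
          _ = (σ (ball z (r / 2)))⁻¹ * σ (ball z (r / 2)) := by simp
          _ ≤ 1 := ENNReal.inv_mul_le_one _
    _ = Fintype.card t := by simp

lemma nu_Ioi (μ : Measure E) (x : E) (r : ℝ) :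
    (tau.withDensity (wf n p μ x)) (Set.Ioi r) = wF n p μ x r :=
  withDensity_apply _ measurableSet_Ioi

lemma nu_univ (μ : Measure E) (x : E) :
    (tau.withDensity (wf n p μ x)) Set.univ = wolff n p μ x := by
  rw [withDensity_apply _ MeasurableSet.univ, wolff_eq, Measure.restrict_univ]

lemma wF_zero (μ : Measure E) (x : E) : wF n p μ x 0 = wolff n p μ x := by
  rw [wolff_eq, wF, ← lintegral_indicator measurableSet_Ioi]
  refine lintegral_congr_ae ?_
  filter_upwards [ae_tau_pos] with r hr
  simp [Set.indicator, hr]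

lemma wF_meas (μ : Measure E) (x : E) : Measurable (wF n p μ x) :=
  Antitone.measurable fun _ _ h => wF_anti μ x h

lemma nu_lint (μ : Measure E) (x : E) (e : ℝ) :
    ∫⁻ r, ((tau.withDensity (wf n p μ x)) (Set.Ioi r)) ^ e ∂(tau.withDensity (wf n p μ x)) =
    ∫⁻ r, wF n p μ x r ^ e * wf n p μ x r ∂tau := by
  simp_rw [nu_Ioi]
  rw [lintegral_withDensity_eq_lintegral_mul _ (wf_meas μ x) ((wF_meas μ x).pow_const e)]
  refine lintegral_congr fun r => ?_
  simp [mul_comm]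

/-- The intermediate function in the Hölder argument. -/
noncomputable def wH (n : ℕ) (p γ : ℝ) (μ σ : Measure (EuclideanSpace ℝ (Fin n)))
    (x : EuclideanSpace ℝ (Fin n)) : ℝ≥0∞ :=
  ∫⁻ r, wF n p μ x r ^ (γ - 1) * wf n p μ x r * (σ (ball x r))⁻¹ * μ (ball x r) ∂tau

lemma wolff_picone (n : ℕ) (p γ : ℝ) (hp : 1 < p) (hγ : 0 < γ) : ∃ C : ℝ≥0∞, C ≠ ⊤ ∧
    ∀ (μ σ : Measure (EuclideanSpace ℝ (Fin n))) (x : EuclideanSpace ℝ (Fin n)),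
      (∀ r, 0 < r → wF n p μ x r ≠ ⊤) → (∀ r, 0 < r → μ (ball x r) ≠ ⊤) →
      (∀ r, 0 < r → σ (ball x r) ≠ ⊤) → (∀ r, 0 < r → σ (ball x r) ≠ 0) →
      wolff n p μ x ^ (p - 1 + γ) ≤ C * (wH n p γ μ σ x * wolff n p σ x ^ (p - 1)) := by
  have hp0 : 0 < p := by linarith
  have ht : 0 < p - 1 := by linarith
  set β := (p - 1 + γ) / p with hβ
  have hβ0 : 0 < β := by positivity
  obtain ⟨C, hC, hlow⟩ := tail_lower β hβ0
  refine ⟨C ^ p, ENNReal.rpow_ne_top_of_nonneg hp0.le hC, fun μ σ x hF hμ hσ hσ0 => ?_⟩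
  have h1 := hlow (tau.withDensity (wf n p μ x)) (fun r hr => by rw [nu_Ioi]; exact hF r hr)
  rw [nu_lint, nu_Ioi, wF_zero] at h1
  set u : ℝ → ℝ≥0∞ := fun r =>
    wF n p μ x r ^ (β - 1) * wf n p μ x r * wf n p σ x r ^ (-((p - 1) / p)) with hu
  set v : ℝ → ℝ≥0∞ := fun r => wf n p σ x r ^ ((p - 1) / p) with hv
  have hum : Measurable u :=
    (((wF_meas μ x).pow_const _).mul (wf_meas μ x)).mul ((wf_meas σ x).pow_const _)
  have hvm : Measurable v := (wf_meas σ x).pow_const _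
  have hg : ∀ r, 0 < r → wf n p σ x r ≠ 0 ∧ wf n p σ x r ≠ ⊤ := by
    intro r hr
    have hrp : ENNReal.ofReal (r ^ ((n : ℝ) - p)) ≠ 0 := by
      rw [Ne, ENNReal.ofReal_eq_zero, not_le]; positivity
    constructor
    · refine (ENNReal.rpow_pos (ENNReal.div_pos (hσ0 r hr) (by simp)) ?_).ne'
      exact ENNReal.div_ne_top (hσ r hr) hrp
    · exact ENNReal.rpow_ne_top_of_nonneg (by positivity) (ENNReal.div_ne_top (hσ r hr) hrp)
  have h2 : ∫⁻ r, wF n p μ x r ^ (β - 1) * wf n p μ x r ∂tau = ∫⁻ r, (u * v) r ∂tau := by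
    refine lintegral_congr_ae ?_
    filter_upwards [ae_tau_pos] with r hr
    simp only [hu, hv, Pi.mul_apply]
    rw [mul_assoc, ← ENNReal.rpow_add _ _ (hg r hr).1 (hg r hr).2, neg_add_cancel,
      ENNReal.rpow_zero, mul_one]
  have hconj : p.HolderConjugate (p / (p - 1)) := Real.HolderConjugate.conjExponent hp
  have h3 := ENNReal.lintegral_mul_le_Lp_mul_Lq tau hconj hum.aemeasurable hvm.aemeasurable
  have h4 : ∫⁻ r, v r ^ (p / (p - 1)) ∂tau = wolff n p σ x := by
    rw [wolff_eq]
    refine lintegral_congr fun r => ?_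
    simp only [hv]
    rw [← ENNReal.rpow_mul, show (p - 1) / p * (p / (p - 1)) = 1 by field_simp, ENNReal.rpow_one]
  have h5 : ∫⁻ r, u r ^ p ∂tau = wH n p γ μ σ x := by
    refine lintegral_congr_ae ?_
    filter_upwards [ae_tau_pos] with r hr
    have hrp : ENNReal.ofReal (r ^ ((n : ℝ) - p)) ≠ 0 := by
      rw [Ne, ENNReal.ofReal_eq_zero, not_le]; positivity
    simp only [hu]
    rw [ENNReal.mul_rpow_of_nonneg _ _ hp0.le, ENNReal.mul_rpow_of_nonneg _ _ hp0.le,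
      ← ENNReal.rpow_mul, ← ENNReal.rpow_mul,
      show (β - 1) * p = γ - 1 by rw [hβ]; field_simp; ring,
      show -((p - 1) / p) * p = -(p - 1) by field_simp]
    have hf : wf n p μ x r ^ p = wf n p μ x r * (μ (ball x r) / ENNReal.ofReal (r ^ ((n : ℝ) - p))) := by
      have e1 : wf n p μ x r ^ p = wf n p μ x r ^ (1 : ℝ) * wf n p μ x r ^ (p - 1) := by
        rw [← ENNReal.rpow_add_of_nonneg _ _ (by norm_num) ht.le]; congr 1; ring
      rw [e1, ENNReal.rpow_one]
      congr 1
      unfold wf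
      rw [← ENNReal.rpow_mul, show 1 / (p - 1) * (p - 1) = 1 by field_simp, ENNReal.rpow_one]
    have hgg : wf n p σ x r ^ (-(p - 1)) =
        ENNReal.ofReal (r ^ ((n : ℝ) - p)) * (σ (ball x r))⁻¹ := by
      unfold wf
      rw [← ENNReal.rpow_mul, show 1 / (p - 1) * (-(p - 1)) = -1 by field_simp,
        ENNReal.rpow_neg_one, ENNReal.inv_div (by simp) (by left; exact hrp), div_eq_mul_inv]
    rw [hf, hgg, div_eq_mul_inv]
    set A := ENNReal.ofReal (r ^ ((n : ℝ) - p))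
    calc wF n p μ x r ^ (γ - 1) * (wf n p μ x r * (μ (ball x r) * A⁻¹)) * (A * (σ (ball x r))⁻¹)
        = wF n p μ x r ^ (γ - 1) * wf n p μ x r * (σ (ball x r))⁻¹ * μ (ball x r) * (A * A⁻¹) := by
          ring
      _ = _ := by rw [ENNReal.mul_inv_cancel hrp (by simp [A]), mul_one]
  rw [h2] at h1
  have h6 := h1.trans (mul_le_mul_right h3 C)
  rw [h4, h5] at h6
  have h7 := ENNReal.rpow_le_rpow h6 hp0.le
  rw [← ENNReal.rpow_mul, show β * p = p - 1 + γ by rw [hβ]; field_simp,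
    ENNReal.mul_rpow_of_nonneg _ _ hp0.le, ENNReal.mul_rpow_of_nonneg _ _ hp0.le,
    ← ENNReal.rpow_mul, ← ENNReal.rpow_mul, show 1 / p * p = 1 by field_simp,
    show 1 / (p / (p - 1)) * p = p - 1 by field_simp, ENNReal.rpow_one] at h7
  exact h7

lemma wF_pow_comp (n : ℕ) (p γ : ℝ) (hp : 1 < p) : ∃ C : ℝ≥0∞, C ≠ ⊤ ∧
    ∀ (μ : Measure (EuclideanSpace ℝ (Fin n))) (x y : EuclideanSpace ℝ (Fin n)) (r : ℝ),
      (∀ x r, 0 < r → wF n p μ x r ≠ ⊤) → 0 < r → dist x y ≤ r →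
      wF n p μ x r ^ (γ - 1) ≤ C * wF n p μ y (2 * r) ^ (γ - 1) := by
  by_cases h : 1 ≤ γ
  · refine ⟨wK n p ^ (γ - 1), ENNReal.rpow_ne_top_of_nonneg (by linarith) (wK_ne_top hp),
      fun μ x y r _ hr hxy => ?_⟩
    rw [← ENNReal.mul_rpow_of_nonneg _ _ (by linarith)]
    exact ENNReal.rpow_le_rpow (wF_le hp μ hr hxy) (by linarith)
  · push Not at h
    refine ⟨wK n p ^ (1 - γ), ENNReal.rpow_ne_top_of_nonneg (by linarith) (wK_ne_top hp),
      fun μ x y r hF hr hxy => ?_⟩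
    have h1 : wF n p μ y (2 * r) ≤ wK n p * wF n p μ x r :=
      calc wF n p μ y (2 * r) ≤ wF n p μ y r := wF_anti μ y (by linarith)
        _ ≤ wK n p * wF n p μ x (2 * r) := wF_le hp μ hr (by rwa [dist_comm])
        _ ≤ _ := mul_le_mul_right (wF_anti μ x (by linarith)) _
    have h2 := rpow_anti_aux h1 (show γ - 1 ≤ 0 by linarith)
    rw [ENNReal.mul_rpow_of_ne_top (wK_ne_top hp) (hF x r hr)] at h2
    calc wF n p μ x r ^ (γ - 1)
        = wK n p ^ (1 - γ) * (wK n p ^ (γ - 1) * wF n p μ x r ^ (γ - 1)) := by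
          rw [← mul_assoc, ← ENNReal.rpow_add _ _ wK_ne_zero (wK_ne_top hp)]
          simp
      _ ≤ _ := mul_le_mul_right h2 _

lemma wH_meas (γ : ℝ) (μ σ : Measure E) [SFinite μ] [SFinite σ] : Measurable (wH n p γ μ σ) := by
  unfold wH
  exact Measurable.lintegral_prod_right' (f := fun z : E × ℝ =>
    wF n p μ z.1 z.2 ^ (γ - 1) * wf n p μ z.1 z.2 * (σ (ball z.1 z.2))⁻¹ * μ (ball z.1 z.2))
    (((((wF_meas2 μ).pow_const _).mul (wf_meas2 μ)).mul (ball_meas σ).inv).mul (ball_meas μ))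

lemma wH_bound (n : ℕ) (p γ : ℝ) (hp : 1 < p) (hγ : 0 < γ) : ∃ C : ℝ≥0∞, C ≠ ⊤ ∧
    ∀ (μ σ : Measure (EuclideanSpace ℝ (Fin n))) [SFinite μ] [SFinite σ],
      (∀ x r, 0 < r → wF n p μ x r ≠ ⊤) →
      ∫⁻ x, wH n p γ μ σ x ∂σ ≤ C * ∫⁻ x, wolff n p μ x ^ γ ∂μ := by
  obtain ⟨C1, hC1, hcomp⟩ := wF_pow_comp n p γ hp
  obtain ⟨N, hN⟩ := cover_aux n
  obtain ⟨C2, hC2, hup⟩ := tail_upper γ hγ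
  refine ⟨C1 * wK n p * N * C2, ENNReal.mul_ne_top (ENNReal.mul_ne_top
    (ENNReal.mul_ne_top hC1 (wK_ne_top hp)) (by simp)) hC2, fun μ σ _ _ hF => ?_⟩
  set K : EuclideanSpace ℝ (Fin n) → ℝ → ℝ≥0∞ := fun x r =>
    wF n p μ x r ^ (γ - 1) * wf n p μ x r * (σ (ball x r))⁻¹ with hK
  have hKm : Measurable fun z : EuclideanSpace ℝ (Fin n) × ℝ => K z.1 z.2 :=
    (((wF_meas2 μ).pow_const _).mul (wf_meas2 μ)).mul (ball_meas σ).inv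
  set L : EuclideanSpace ℝ (Fin n) → ℝ → ℝ≥0∞ := fun y r =>
    wF n p μ y r ^ (γ - 1) * wf n p μ y r with hL
  have hLm : Measurable fun z : EuclideanSpace ℝ (Fin n) × ℝ => L z.1 z.2 :=
    ((wF_meas2 μ).pow_const _).mul (wf_meas2 μ)
  have hin : ∀ r, 0 < r → ∫⁻ x, K x r * μ (ball x r) ∂σ ≤
      ∫⁻ y, C1 * wK n p * N * L y (2 * r) ∂μ := by
    intro r hr
    have hKr : Measurable fun x => K x r := hKm.comp (f := fun x => (x, r)) (by fun_prop)
    have e1 : ∫⁻ x, K x r * μ (ball x r) ∂σ =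
        ∫⁻ x, ∫⁻ y, (ball y r).indicator (fun x => K x r) x ∂μ ∂σ := by
      refine lintegral_congr fun x => ?_
      rw [← setLIntegral_const, ← lintegral_indicator measurableSet_ball]
      refine lintegral_congr fun y => ?_
      simp [Set.indicator, dist_comm]
    have hm : Measurable (Function.uncurry fun x y : EuclideanSpace ℝ (Fin n) =>
        (ball y r).indicator (fun x => K x r) x) := by
      have : Measurable fun z : EuclideanSpace ℝ (Fin n) × EuclideanSpace ℝ (Fin n) => K z.1 r :=
        hKr.comp measurable_fst
      exact this.indicator (s := {z | dist z.1 z.2 < r})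
        (measurableSet_lt (by fun_prop) (by fun_prop))
    rw [e1, lintegral_lintegral_swap hm.aemeasurable]
    refine lintegral_mono fun y => ?_
    rw [lintegral_indicator measurableSet_ball]
    calc ∫⁻ x in ball y r, K x r ∂σ
        ≤ ∫⁻ x in ball y r, C1 * wK n p * L y (2 * r) * (σ (ball x r))⁻¹ ∂σ := by
          refine setLIntegral_mono' measurableSet_ball fun x hx => ?_
          have hd : dist x y ≤ r := (mem_ball.1 hx).le
          have a1 := hcomp μ x y r hF hr hd
          have a2 := wf_le hp μ hr hd
          calc K x r ≤ (C1 * wF n p μ y (2 * r) ^ (γ - 1)) * (wK n p * wf n p μ y (2 * r)) *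
                (σ (ball x r))⁻¹ := by simp only [hK]; gcongr
            _ = _ := by simp only [hL]; ring
      _ = C1 * wK n p * L y (2 * r) * ∫⁻ x in ball y r, (σ (ball x r))⁻¹ ∂σ :=
          lintegral_const_mul _
            ((ball_meas σ).inv.comp (f := fun x => (x, r)) (by fun_prop))
      _ ≤ C1 * wK n p * L y (2 * r) * N := mul_le_mul_right (hN σ y r hr) _
      _ = _ := by ring
  have hLy : ∀ y, Measurable (L y) := fun y => hLm.comp (f := fun r => (y, r)) (by fun_prop)
  calc ∫⁻ x, wH n p γ μ σ x ∂σ = ∫⁻ x, ∫⁻ r, K x r * μ (ball x r) ∂tau ∂σ := rfl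
    _ = ∫⁻ r, ∫⁻ x, K x r * μ (ball x r) ∂σ ∂tau :=
        lintegral_lintegral_swap (hKm.mul (ball_meas μ)).aemeasurable
    _ ≤ ∫⁻ r, ∫⁻ y, C1 * wK n p * N * L y (2 * r) ∂μ ∂tau := by
        refine lintegral_mono_ae ?_
        filter_upwards [ae_tau_pos] with r hr using hin r hr
    _ = ∫⁻ y, ∫⁻ r, C1 * wK n p * N * L y (2 * r) ∂tau ∂μ := by
        refine lintegral_lintegral_swap (Measurable.aemeasurable ?_)
        exact (hLm.comp (f := fun z : ℝ × EuclideanSpace ℝ (Fin n) => (z.2, 2 * z.1))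
          (by fun_prop)).const_mul _
    _ = ∫⁻ y, C1 * wK n p * N * ∫⁻ r, L y r ∂tau ∂μ := by
        refine lintegral_congr fun y => ?_
        rw [lintegral_const_mul (f := fun r => L y (2 * r)) _
          ((hLy y).comp (measurable_const_mul 2)), tau_scale _ (hLy y)]
    _ ≤ ∫⁻ y, C1 * wK n p * N * (C2 * wolff n p μ y ^ γ) ∂μ := by
        refine lintegral_mono fun y => mul_le_mul_right ?_ _
        have := hup (tau.withDensity (wf n p μ y))
        rwa [nu_lint, nu_univ] at this
    _ = _ := by
        rw [lintegral_const_mul _ (((wolff_meas μ).pow_const γ).const_mul _),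
          lintegral_const_mul _ ((wolff_meas μ).pow_const γ)]
        ring

end

/-- Mutual energy estimate for Wolff potentials (Theorem 3.1). -/
theorem wolff_mutual_energy_estimate (n : ℕ) (p γ q : ℝ)
    (hp : 1 < p) (hpn : p < n) (hγ : 0 < γ) (hq1 : -γ < q) (hq2 : q < p - 1) :
    ∃ C : ℝ≥0∞, 0 < C ∧ C < ⊤ ∧
      ∀ μ σ : Measure (EuclideanSpace ℝ (Fin n)),
        ∫⁻ x, (wolff n p μ x) ^ (γ + q) ∂σ ≤
          C * (∫⁻ x, (wolff n p μ x) ^ γ ∂μ) ^ ((γ + q) / (p - 1 + γ)) *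
            (∫⁻ x, (wolff n p σ x) ^ ((γ + q) * (p - 1) / (p - 1 - q)) ∂σ) ^
              ((p - 1 - q) / (p - 1 + γ)) := by
  obtain ⟨C1, hC1, hpic⟩ := wolff_picone n p γ hp hγ
  obtain ⟨C2, hC2, hH⟩ := wH_bound n p γ hp hγ
  have ht : 0 < p - 1 := by linarith
  have ha : 0 < γ + q := by linarith
  have hb : 0 < p - 1 + γ := by linarith
  have hba : 0 < p - 1 - q := by linarith
  have hab : 0 < (γ + q) / (p - 1 + γ) := by positivity
  have hbab : 0 < (p - 1 - q) / (p - 1 + γ) := by positivity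
  have hee : 0 < (γ + q) * (p - 1) / (p - 1 - q) := by positivity
  set C : ℝ≥0∞ := C1 ^ ((γ + q) / (p - 1 + γ)) * C2 ^ ((γ + q) / (p - 1 + γ)) + 1 with hC
  have hCt : C ≠ ⊤ := ENNReal.add_ne_top.2 ⟨ENNReal.mul_ne_top
    (ENNReal.rpow_ne_top_of_nonneg hab.le hC1) (ENNReal.rpow_ne_top_of_nonneg hab.le hC2),
    one_ne_top⟩
  have hC0 : C ≠ 0 := by simp [hC]
  refine ⟨C, hC0.bot_lt, hCt.lt_top, fun μ σ => ?_⟩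
  by_cases hμ : μ = 0
  · have : ∀ x, wolff n p μ x = 0 := by
      intro x
      simp [wolff, hμ, ENNReal.zero_rpow_of_pos (inv_pos.2 ht)]
    simp [this, ENNReal.zero_rpow_of_pos ha]
  by_cases hσ : σ = 0
  · simp [hσ]
  have e1 := energy_ne_zero hp hpn μ hμ γ hγ
  have e2 := energy_ne_zero hp hpn σ hσ _ hee
  have e1' : (∫⁻ x, (wolff n p μ x) ^ γ ∂μ) ^ ((γ + q) / (p - 1 + γ)) ≠ 0 := by
    rwa [Ne, ENNReal.rpow_eq_zero_iff_of_pos hab]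
  have e2' : (∫⁻ x, (wolff n p σ x) ^ ((γ + q) * (p - 1) / (p - 1 - q)) ∂σ) ^
      ((p - 1 - q) / (p - 1 + γ)) ≠ 0 := by
    rwa [Ne, ENNReal.rpow_eq_zero_iff_of_pos hbab]
  rcases wolff_dich hp hpn μ with hFμ | hFμ
  · have : ∫⁻ x, (wolff n p μ x) ^ γ ∂μ = ⊤ := by
      simp [hFμ, ENNReal.top_rpow_of_pos hγ, ENNReal.top_mul, hμ]
    rw [this, ENNReal.top_rpow_of_pos hab, ENNReal.mul_top hC0, ENNReal.top_mul e2']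
    exact le_top
  rcases wolff_dich hp hpn σ with hFσ | hFσ
  · have : ∫⁻ x, (wolff n p σ x) ^ ((γ + q) * (p - 1) / (p - 1 - q)) ∂σ = ⊤ := by
      simp only [hFσ, ENNReal.top_rpow_of_pos hee]
      simp [ENNReal.top_mul, hσ]
    rw [this, ENNReal.top_rpow_of_pos hbab, ENNReal.mul_top (mul_ne_zero hC0 e1')]
    exact le_top
  have := sfin_aux hp μ hFμ
  have := sfin_aux hp σ hFσ
  have hsupp : ∀ᵐ x ∂σ, ∀ r, 0 < r → σ (ball x r) ≠ 0 := by
    filter_upwards [Measure.support_mem_ae (μ := σ)] with x hx r hr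
    exact ((Measure.mem_support_iff_forall x).1 hx _ (ball_mem_nhds x hr)).ne'
  set a := (γ + q) / (p - 1 + γ) with hadef
  have hpt : ∀ᵐ x ∂σ, wolff n p μ x ^ (γ + q) ≤
      C1 ^ a * (((fun x => wH n p γ μ σ x ^ a) * fun x => wolff n p σ x ^ ((p - 1) * a)) x) := by
    filter_upwards [hsupp] with x hx
    have h := hpic μ σ x (hFμ x) (ball_ne_top hp μ hFμ x) (ball_ne_top hp σ hFσ x) hx
    have h' := ENNReal.rpow_le_rpow h hab.le
    rw [← ENNReal.rpow_mul, ENNReal.mul_rpow_of_nonneg _ _ hab.le,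
      ENNReal.mul_rpow_of_nonneg _ _ hab.le, ← ENNReal.rpow_mul,
      show (p - 1 + γ) * a = γ + q by rw [hadef]; field_simp] at h'
    exact h'
  have hm1 : Measurable fun x => wH n p γ μ σ x ^ a := (wH_meas γ μ σ).pow_const _
  have hm2 : Measurable fun x => wolff n p σ x ^ ((p - 1) * a) := (wolff_meas σ).pow_const _
  have hconj : ((p - 1 + γ) / (γ + q)).HolderConjugate ((p - 1 + γ) / (p - 1 - q)) := by
    rw [Real.holderConjugate_iff]
    refine ⟨by rw [one_lt_div ha]; linarith, ?_⟩
    field_simp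
    ring
  have hhol := ENNReal.lintegral_mul_le_Lp_mul_Lq σ hconj hm1.aemeasurable hm2.aemeasurable
  have s1 : ∀ x, (wH n p γ μ σ x ^ a) ^ ((p - 1 + γ) / (γ + q)) = wH n p γ μ σ x := by
    intro x
    rw [← ENNReal.rpow_mul, show a * ((p - 1 + γ) / (γ + q)) = 1 by rw [hadef]; field_simp,
      ENNReal.rpow_one]
  have s2 : ∀ x, (wolff n p σ x ^ ((p - 1) * a)) ^ ((p - 1 + γ) / (p - 1 - q)) =
      wolff n p σ x ^ ((γ + q) * (p - 1) / (p - 1 - q)) := by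
    intro x
    rw [← ENNReal.rpow_mul]
    congr 1
    rw [hadef]; field_simp
  simp_rw [s1, s2, one_div_div] at hhol
  rw [← hadef] at hhol
  calc ∫⁻ x, (wolff n p μ x) ^ (γ + q) ∂σ
      ≤ ∫⁻ x, C1 ^ a * (((fun x => wH n p γ μ σ x ^ a) *
          fun x => wolff n p σ x ^ ((p - 1) * a)) x) ∂σ := lintegral_mono_ae hpt
    _ = C1 ^ a * ∫⁻ x, (((fun x => wH n p γ μ σ x ^ a) *
          fun x => wolff n p σ x ^ ((p - 1) * a)) x) ∂σ := lintegral_const_mul _ (hm1.mul hm2)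
    _ ≤ C1 ^ a * ((C2 * ∫⁻ x, wolff n p μ x ^ γ ∂μ) ^ a *
          (∫⁻ x, (wolff n p σ x) ^ ((γ + q) * (p - 1) / (p - 1 - q)) ∂σ) ^
              ((p - 1 - q) / (p - 1 + γ))) := by
        refine mul_le_mul_right (hhol.trans ?_) _
        gcongr
        exact hH μ σ hFμ
    _ = (C1 ^ a * C2 ^ a) * (∫⁻ x, wolff n p μ x ^ γ ∂μ) ^ a *
          (∫⁻ x, (wolff n p σ x) ^ ((γ + q) * (p - 1) / (p - 1 - q)) ∂σ) ^
              ((p - 1 - q) / (p - 1 + γ)) := by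
        rw [ENNReal.mul_rpow_of_nonneg _ _ hab.le]; ring
    _ ≤ _ := by
        gcongr
        exact le_self_add
end

section
/- Let $1 < p < n$ and $0 < \gamma < \infty$. Then for any nonnegative Radon measures $\mu, \nu$ on $\mathbb{R}^n$, the generalized energy is quasi-additive: $\int_{\mathbb{R}^n} (\mathbf{W}_{1,p}(\mu+\nu))^\gamma\, d(\mu+\nu) \approx \int_{\mathbb{R}^n} (\mathbf{W}_{1,p}\mu)^\gamma\, d\mu + \int_{\mathbb{R}^n} (\mathbf{W}_{1,p}\nu)^\gamma\, d\nu$, where the implicit constants depend only on $n$, $p$, and $\gamma$. -/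
open MeasureTheory Metric ENNReal

open Set Filter Topology

/-- The integrand of the Wolff potential. -/
noncomputable def wolffKer (n : ℕ) (p : ℝ) (σ : Measure (EuclideanSpace ℝ (Fin n)))
    (x : EuclideanSpace ℝ (Fin n)) (r : ℝ) : ℝ≥0∞ :=
  (σ (ball x r) / ENNReal.ofReal (r ^ ((n : ℝ) - p))) ^ (1 / (p - 1)) / ENNReal.ofReal r

lemma wolff_eq_s5 (n : ℕ) (p : ℝ) (σ : Measure (EuclideanSpace ℝ (Fin n)))
    (x : EuclideanSpace ℝ (Fin n)) : wolff n p σ x = ∫⁻ r in Ioi (0 : ℝ), wolffKer n p σ x r := rfl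

lemma measurable_ball_measure {n : ℕ} (σ : Measure (EuclideanSpace ℝ (Fin n))) :
    Measurable (fun z : EuclideanSpace ℝ (Fin n) × ℝ => σ (ball z.1 z.2)) := by
  apply LowerSemicontinuous.measurable
  rintro ⟨x, r⟩ t ht
  simp only at ht
  have hU : ball x r = ⋃ k : ℕ, ball x (r - 1 / ((k : ℝ) + 1)) := by
    ext y
    simp only [mem_ball, mem_iUnion]
    constructor
    · intro h
      obtain ⟨k, hk⟩ := exists_nat_one_div_lt (sub_pos.2 h)
      exact ⟨k, by linarith⟩
    · rintro ⟨k, hk⟩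
      have : (0 : ℝ) < 1 / ((k : ℝ) + 1) := by positivity
      linarith
  have hmono : Monotone (fun k : ℕ => ball x (r - 1 / ((k : ℝ) + 1))) := by
    intro a b hab
    apply ball_subset_ball
    have : (1 : ℝ) / ((b : ℝ) + 1) ≤ 1 / ((a : ℝ) + 1) :=
      Nat.one_div_le_one_div hab
    linarith
  rw [hU, hmono.measure_iUnion, gt_iff_lt, lt_iSup_iff] at ht
  obtain ⟨k, hk⟩ := ht
  set ε : ℝ := 1 / ((k : ℝ) + 1) with hε
  have hε0 : 0 < ε := by positivity
  have h1 : ∀ᶠ z : EuclideanSpace ℝ (Fin n) × ℝ in 𝓝 (x, r), dist z (x, r) < ε / 2 :=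
    Metric.eventually_nhds_iff.2 ⟨ε / 2, by positivity, fun _ h => h⟩
  filter_upwards [h1] with z hz
  refine lt_of_lt_of_le hk (measure_mono ?_)
  rw [Prod.dist_eq, max_lt_iff] at hz
  have h2 := hz.2
  rw [Real.dist_eq, abs_lt] at h2
  apply ball_subset_ball'
  have h3 := hz.1
  rw [dist_comm] at h3
  simp only at h2 h3
  linarith [h2.1]

lemma measurable_wolffKer (n : ℕ) (p : ℝ) (σ : Measure (EuclideanSpace ℝ (Fin n))) :
    Measurable (fun z : EuclideanSpace ℝ (Fin n) × ℝ => wolffKer n p σ z.1 z.2) := by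
  unfold wolffKer
  have h := measurable_ball_measure σ
  have h2 : Measurable (fun z : EuclideanSpace ℝ (Fin n) × ℝ =>
    ENNReal.ofReal (z.2 ^ ((n : ℝ) - p))) := by fun_prop
  have h3 : Measurable (fun z : EuclideanSpace ℝ (Fin n) × ℝ => ENNReal.ofReal z.2) := by fun_prop
  exact ((h.div h2).pow_const _).div h3

lemma measurable_wolffKer_right (n : ℕ) (p : ℝ) (σ : Measure (EuclideanSpace ℝ (Fin n)))
    (x : EuclideanSpace ℝ (Fin n)) : Measurable (wolffKer n p σ x) := by
  have h : Measurable (fun r : ℝ => (x, r)) := measurable_prodMk_left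
  have h2 := (measurable_wolffKer n p σ).comp h
  simp only [Function.comp_def] at h2
  exact h2

lemma measurable_wolff (n : ℕ) (p : ℝ) (σ : Measure (EuclideanSpace ℝ (Fin n))) :
    Measurable (wolff n p σ) :=
  (measurable_wolffKer n p σ).lintegral_prod_right'

lemma wolffKer_mono {n : ℕ} {p : ℝ} (hp : 1 < p) {σ τ : Measure (EuclideanSpace ℝ (Fin n))}
    {x y : EuclideanSpace ℝ (Fin n)} {r : ℝ} (h : σ (ball x r) ≤ τ (ball y r)) :
    wolffKer n p σ x r ≤ wolffKer n p τ y r := by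
  have : 0 ≤ 1 / (p - 1) := by
    have : 0 < p - 1 := by linarith
    positivity
  unfold wolffKer
  gcongr

lemma wolff_mono {n : ℕ} {p : ℝ} (hp : 1 < p) {σ τ : Measure (EuclideanSpace ℝ (Fin n))}
    (h : σ ≤ τ) (x : EuclideanSpace ℝ (Fin n)) : wolff n p σ x ≤ wolff n p τ x :=
  lintegral_mono fun _ => wolffKer_mono hp (h _)

lemma wolff_add_le {n : ℕ} {p : ℝ} (hp : 1 < p) (σ τ : Measure (EuclideanSpace ℝ (Fin n)))
    (x : EuclideanSpace ℝ (Fin n)) :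
    wolff n p (σ + τ) x ≤ 2 ^ (1 / (p - 1)) * (wolff n p σ x + wolff n p τ x) := by
  have hq : 0 ≤ 1 / (p - 1) := by
    have : 0 < p - 1 := by linarith
    positivity
  simp only [wolff_eq_s5]
  rw [← lintegral_add_left (measurable_wolffKer_right n p σ x), ← lintegral_const_mul]
  · refine lintegral_mono fun r => ?_
    simp only [wolffKer, Measure.add_apply, ENNReal.add_div]
    simp only [← ENNReal.add_div]
    rw [← mul_div_assoc]
    apply ENNReal.div_le_div_right
    rw [ENNReal.add_div]
    exact ENNReal.add_rpow_le_two_rpow_mul_rpow_add_rpow _ _ hq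
  · exact (measurable_wolffKer_right n p σ x).add (measurable_wolffKer_right n p τ x)

lemma lintegral_scale {f : ℝ → ℝ≥0∞} (hf : Measurable f) :
    ∫⁻ r in Ioi (0 : ℝ), f r = 2 * ∫⁻ r in Ioi (0 : ℝ), f (2 * r) := by
  rw [← lintegral_indicator measurableSet_Ioi, ← lintegral_indicator measurableSet_Ioi]
  conv_lhs => rw [← Real.smul_map_volume_mul_left (two_ne_zero (α := ℝ))]
  rw [lintegral_smul_measure, lintegral_map (hf.indicator measurableSet_Ioi) (by fun_prop)]
  simp only [smul_eq_mul]
  congr 1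
  · norm_num
  · congr 1
    ext r
    simp only [indicator, mem_Ioi]
    congr 1
    simp

/-- The constant from doubling the radius. -/
noncomputable def dblC (n : ℕ) (p : ℝ) : ℝ≥0∞ :=
  (ENNReal.ofReal (2 ^ ((n : ℝ) - p))) ^ (1 / (p - 1))

lemma wolff_double {n : ℕ} {p : ℝ} (hp : 1 < p) (σ : Measure (EuclideanSpace ℝ (Fin n)))
    (x y : EuclideanSpace ℝ (Fin n)) (G : Set ℝ) (hG : G ⊆ Ioi 0)
    (h : ∀ r ∈ G, ball x r ⊆ ball y (2 * r)) :
    ∫⁻ r in G, wolffKer n p σ x r ≤ dblC n p * wolff n p σ y := by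
  have hq : 0 ≤ 1 / (p - 1) := by
    have : 0 < p - 1 := by linarith
    positivity
  have hm := measurable_wolffKer_right n p σ y
  rw [wolff_eq_s5, lintegral_scale hm, ← mul_assoc, ← lintegral_const_mul _ (by fun_prop)]
  refine le_trans ?_ (lintegral_mono_set hG)
  refine setLIntegral_mono (by fun_prop) fun r hr => ?_
  have hr0 : 0 < r := hG hr
  unfold wolffKer dblC
  have e1 : ENNReal.ofReal ((2 * r) ^ ((n : ℝ) - p)) =
      ENNReal.ofReal (2 ^ ((n : ℝ) - p)) * ENNReal.ofReal (r ^ ((n : ℝ) - p)) := by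
    rw [Real.mul_rpow (by norm_num) hr0.le, ENNReal.ofReal_mul (by positivity)]
  have e2 : ENNReal.ofReal (2 * r) = 2 * ENNReal.ofReal r := by
    rw [ENNReal.ofReal_mul (by norm_num)]; norm_num
  have a0 : ENNReal.ofReal (2 ^ ((n : ℝ) - p)) ≠ 0 := by
    simp only [ne_eq, ENNReal.ofReal_eq_zero, not_le]; positivity
  rw [e1, e2, mul_assoc]
  rw [← mul_div_assoc 2, ENNReal.mul_div_mul_left _ _ (by norm_num) (by norm_num),
    ← mul_div_assoc, ← ENNReal.mul_rpow_of_nonneg _ _ hq, ← mul_div_assoc,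
    ENNReal.mul_div_mul_left _ _ a0 ENNReal.ofReal_ne_top]
  gcongr
  exact h r hr

lemma exists_threshold (ρ : Measure ℝ) (G : Set ℝ) (hG : G ⊆ Ioi 0) (t : ℝ≥0∞)
    (ht : t < ρ G) : ∃ r ∈ G, t < ρ (G ∩ Ici r) := by
  have hne : G.Nonempty := by
    rw [nonempty_iff_ne_empty]; rintro rfl; simp at ht
  have hb : BddBelow G := ⟨0, fun r hr => (hG hr).le⟩
  by_cases hs : sInf G ∈ G
  · refine ⟨_, hs, ?_⟩
    rwa [inter_eq_left.2]
    exact fun r hr => csInf_le hb hr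
  obtain ⟨u, hu, hlim, huG⟩ := exists_seq_tendsto_sInf hne hb
  have hU : G = ⋃ k, G ∩ Ici (u k) := by
    ext r
    simp only [mem_iUnion, mem_inter_iff, mem_Ici]
    refine ⟨fun hr => ?_, fun ⟨_, h, _⟩ => h⟩
    have : sInf G < r := lt_of_le_of_ne (csInf_le hb hr) (fun h => hs (h ▸ hr))
    obtain ⟨k, hk⟩ := (hlim.eventually_lt_const this).exists
    exact ⟨k, hr, hk.le⟩
  have hmono : Monotone (fun k => G ∩ Ici (u k)) := fun a b hab =>
    inter_subset_inter_right _ (Ici_subset_Ici.2 (hu hab))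
  rw [hU, hmono.measure_iUnion, lt_iSup_iff] at ht
  obtain ⟨k, hk⟩ := ht
  exact ⟨u k, huG k, hk⟩

lemma layer {α : Type*} [MeasurableSpace α] (μ ν : Measure α) (N : ℕ) (h g : α → ℝ≥0∞)
    (hg : Measurable g) (H : ∀ t, ν {x | t < h x} ≤ N * μ {x | t < g x}) :
    ∫⁻ x, h x ∂ν ≤ N * ∫⁻ x, g x ∂μ := by
  obtain ⟨f, hf, hfh, hfe⟩ := exists_measurable_le_lintegral_eq ν h
  rw [hfe]
  have key : ∀ k : ℕ, ∫⁻ x, min (f x) k ∂ν ≤ N * ∫⁻ x, g x ∂μ := by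
    intro k
    have aux : ∀ (m : Measure α) (φ : α → ℝ≥0∞), Measurable φ → ∫⁻ x, min (φ x) k ∂m =
        ∫⁻ t in Ioi (0 : ℝ), m {x | ENNReal.ofReal t < min (φ x) k} := by
      intro m φ hφ
      have hfin : ∀ x, min (φ x) (k : ℝ≥0∞) ≠ ⊤ := fun x =>
        ne_top_of_le_ne_top (ENNReal.natCast_ne_top k) (min_le_right _ _)
      have := lintegral_eq_lintegral_meas_lt (f := fun x => (min (φ x) (k : ℝ≥0∞)).toReal) m
        (Eventually.of_forall fun x => ENNReal.toReal_nonneg) (by fun_prop)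
      simp only [ENNReal.ofReal_toReal (hfin _)] at this
      rw [this]
      refine setLIntegral_congr_fun measurableSet_Ioi fun t ht => ?_
      simp only [ENNReal.ofReal_lt_iff_lt_toReal (le_of_lt ht) (hfin _)]
    calc ∫⁻ x, min (f x) k ∂ν = _ := aux ν f hf
      _ ≤ ∫⁻ t in Ioi (0 : ℝ), N * μ {x | ENNReal.ofReal t < min (g x) k} := by
        refine lintegral_mono fun t => ?_
        by_cases htk : ENNReal.ofReal t < k
        · simp only [lt_min_iff, htk, and_true]
          refine le_trans (measure_mono fun x hx => ?_) (H _)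
          exact lt_of_lt_of_le hx (hfh x)
        · simp [lt_min_iff, htk]
      _ = N * ∫⁻ x, min (g x) k ∂μ := by
        rw [lintegral_const_mul' _ _ (ENNReal.natCast_ne_top N), aux μ g hg]
      _ ≤ _ := by
        gcongr
        exact min_le_left _ _
  have hsup : ∀ x, f x = ⨆ k : ℕ, min (f x) (k : ℝ≥0∞) := by
    intro x
    have h1 : (⨆ k : ℕ, min (f x) (k : ℝ≥0∞)) = min (f x) (⨆ k : ℕ, (k : ℝ≥0∞)) :=
      (inf_iSup_eq (f x) _).symm
    rw [h1, ENNReal.iSup_natCast]; simp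
  have hE : ∫⁻ x, f x ∂ν = ⨆ k : ℕ, ∫⁻ x, min (f x) (k : ℝ≥0∞) ∂ν := by
    rw [← lintegral_iSup (fun k => by fun_prop)]
    · exact lintegral_congr hsup
    · intro a b hab x
      simp only
      gcongr
  rw [hE]
  exact iSup_le key

/-- Good radii: those for which `μ` dominates `ν`. -/
def goodR {n : ℕ} (μ ν : Measure (EuclideanSpace ℝ (Fin n))) (x : EuclideanSpace ℝ (Fin n)) :
    Set ℝ := {r | 0 < r ∧ ν (ball x r) ≤ μ (ball x r)}

lemma measurableSet_goodR {n : ℕ} (μ ν : Measure (EuclideanSpace ℝ (Fin n)))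
    (x : EuclideanSpace ℝ (Fin n)) : MeasurableSet (goodR μ ν x) := by
  have h : Measurable (fun r : ℝ => (x, r)) := measurable_prodMk_left
  have h1 := (measurable_ball_measure ν).comp h
  have h2 := (measurable_ball_measure μ).comp h
  exact measurableSet_Ioi.inter (measurableSet_le h1 h2)

lemma distr {n : ℕ} {p : ℝ} (hp : 1 < p) {N : ℕ} {τ : ℝ} (hτ : 1 < τ)
    (hN : IsEmpty (Besicovitch.SatelliteConfig (EuclideanSpace ℝ (Fin n)) N τ))
    (μ ν : Measure (EuclideanSpace ℝ (Fin n))) (t : ℝ≥0∞) :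
    ν {x | t < ∫⁻ r in goodR μ ν x, wolffKer n p μ x r} ≤
      N * μ {y | t < dblC n p * wolff n p μ y} := by
  let E : ℕ → Set (EuclideanSpace ℝ (Fin n)) := fun m =>
    {x | ∃ r ∈ goodR μ ν x, r ≤ m ∧ t < ∫⁻ r in goodR μ ν x ∩ Ici r, wolffKer n p μ x r}
  have hsub : {x | t < ∫⁻ r in goodR μ ν x, wolffKer n p μ x r} ⊆ ⋃ m, E m := by
    intro x hx
    have hx' : t < (volume.withDensity (wolffKer n p μ x)) (goodR μ ν x) := by
      rwa [withDensity_apply _ (measurableSet_goodR μ ν x)]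
    obtain ⟨r, hr, hrt⟩ := exists_threshold _ _ (fun r hr => hr.1) t hx'
    rw [withDensity_apply _ ((measurableSet_goodR μ ν x).inter measurableSet_Ici)] at hrt
    obtain ⟨m, hm⟩ := exists_nat_ge r
    exact mem_iUnion.2 ⟨m, r, hr, hm, hrt⟩
  have hmono : Monotone E := by
    rintro a b hab x ⟨r, hr, hra, h⟩
    exact ⟨r, hr, hra.trans (by exact_mod_cast hab), h⟩
  refine (measure_mono hsub).trans ?_
  rw [hmono.measure_iUnion]
  refine iSup_le fun m => ?_
  have hE : ∀ x : E m, ∃ r ∈ goodR μ ν x.1, r ≤ m ∧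
    t < ∫⁻ r in goodR μ ν x.1 ∩ Ici r, wolffKer n p μ x.1 r := fun x => x.2
  choose R hRG hRm hRt using hE
  let P : Besicovitch.BallPackage (E m) (EuclideanSpace ℝ (Fin n)) :=
    { c := fun x => x.1, r := R, rpos := fun x => (hRG x).1, r_bound := m, r_le := hRm }
  obtain ⟨s, hs, hcov⟩ := Besicovitch.exist_disjoint_covering_families hτ hN P
  have hcov' : E m ⊆ ⋃ i : Fin N, ⋃ j ∈ s i, ball j.1 (R j) := by
    intro x hx
    exact hcov ⟨⟨x, hx⟩, rfl⟩
  have hdisj : ∀ i, (s i).PairwiseDisjoint fun j => ball j.1 (R j) := fun i =>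
    (hs i).mono fun j => ball_subset_closedBall
  have hcount : ∀ i, (s i).Countable := fun i =>
    (hdisj i).countable_of_isOpen (fun j _ => isOpen_ball)
      (fun j _ => ⟨j.1, mem_ball_self (hRG j).1⟩)
  have hball : ∀ j, ball j.1 (R j) ⊆ {y | t < dblC n p * wolff n p μ y} := by
    intro j y hy
    refine lt_of_lt_of_le (hRt j) (wolff_double hp μ j.1 y _ (fun r hr => hr.1.1) ?_)
    intro r hr
    apply ball_subset_ball'
    rw [mem_ball, dist_comm] at hy
    have : R j ≤ r := hr.2
    linarith
  calc ν (E m) ≤ ν (⋃ i : Fin N, ⋃ j ∈ s i, ball j.1 (R j)) := measure_mono hcov'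
    _ ≤ ∑ i : Fin N, ν (⋃ j ∈ s i, ball j.1 (R j)) := measure_iUnion_fintype_le _ _
    _ ≤ ∑ i : Fin N, μ {y | t < dblC n p * wolff n p μ y} := by
      refine Finset.sum_le_sum fun i _ => ?_
      calc ν (⋃ j ∈ s i, ball j.1 (R j)) ≤ ∑' j : s i, ν (ball j.1.1 (R j.1)) :=
            measure_biUnion_le _ (hcount i) _
        _ ≤ ∑' j : s i, μ (ball j.1.1 (R j.1)) :=
            ENNReal.tsum_le_tsum fun j => (hRG j.1).2
        _ = μ (⋃ j ∈ s i, ball j.1 (R j)) :=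
            (measure_biUnion (hcount i) (hdisj i) (fun j _ => measurableSet_ball)).symm
        _ ≤ _ := measure_mono (iUnion₂_subset fun j _ => hball j)
    _ = _ := by simp

lemma wolff_split {n : ℕ} {p : ℝ} (hp : 1 < p) (μ ν : Measure (EuclideanSpace ℝ (Fin n)))
    (x : EuclideanSpace ℝ (Fin n)) :
    wolff n p μ x ≤ wolff n p ν x + ∫⁻ r in goodR μ ν x, wolffKer n p μ x r := by
  have hU : Ioi (0 : ℝ) ⊆ (Ioi 0 \ goodR μ ν x) ∪ goodR μ ν x := by
    intro r hr
    by_cases h : r ∈ goodR μ ν x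
    · exact Or.inr h
    · exact Or.inl ⟨hr, h⟩
  rw [wolff_eq_s5]
  refine (lintegral_mono_set hU).trans ((lintegral_union_le _ _ _).trans ?_)
  gcongr
  refine le_trans ?_ (lintegral_mono_set (sdiff_subset (t := goodR μ ν x)))
  refine setLIntegral_mono (measurable_wolffKer_right n p ν x) fun r hr => ?_
  apply wolffKer_mono hp
  by_contra hc
  exact hr.2 ⟨hr.1, (not_le.1 hc).le⟩

lemma cross {n : ℕ} {p γ : ℝ} (hp : 1 < p) (hγ : 0 < γ) {N : ℕ} {τ : ℝ} (hτ : 1 < τ)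
    (hN : IsEmpty (Besicovitch.SatelliteConfig (EuclideanSpace ℝ (Fin n)) N τ))
    (μ ν : Measure (EuclideanSpace ℝ (Fin n))) :
    ∫⁻ x, (wolff n p μ x) ^ γ ∂ν ≤ 2 ^ γ * (∫⁻ x, (wolff n p ν x) ^ γ ∂ν +
      N * dblC n p ^ γ * ∫⁻ x, (wolff n p μ x) ^ γ ∂μ) := by
  have hmν := measurable_wolff n p ν
  have hmμ := measurable_wolff n p μ
  have h2 : (2 : ℝ≥0∞) ^ γ ≠ ⊤ := ENNReal.rpow_ne_top_of_nonneg hγ.le (by norm_num)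
  calc ∫⁻ x, (wolff n p μ x) ^ γ ∂ν
      ≤ ∫⁻ x, 2 ^ γ * ((wolff n p ν x) ^ γ +
          (∫⁻ r in goodR μ ν x, wolffKer n p μ x r) ^ γ) ∂ν := by
        refine lintegral_mono fun x => ?_
        exact (ENNReal.rpow_le_rpow (wolff_split hp μ ν x) hγ.le).trans
          (ENNReal.add_rpow_le_two_rpow_mul_rpow_add_rpow _ _ hγ.le)
    _ = 2 ^ γ * (∫⁻ x, (wolff n p ν x) ^ γ ∂ν +
          ∫⁻ x, (∫⁻ r in goodR μ ν x, wolffKer n p μ x r) ^ γ ∂ν) := by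
        rw [lintegral_const_mul' _ _ h2, lintegral_add_left (hmν.pow_const _)]
    _ ≤ _ := by
        gcongr
        refine (layer μ ν N _ (fun x => (dblC n p * wolff n p μ x) ^ γ)
          ((hmμ.const_mul _).pow_const _) fun t => ?_).trans ?_
        · have e : ∀ a : ℝ≥0∞, t < a ^ γ ↔ t ^ (1 / γ) < a := fun a => by
            rw [one_div, ENNReal.rpow_inv_lt_iff hγ]
          simp only [e]
          exact distr hp hτ hN μ ν _
        · simp only [ENNReal.mul_rpow_of_nonneg _ _ hγ.le]
          rw [lintegral_const_mul _ (hmμ.pow_const _), mul_assoc]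

/-- Quasi-additivity of the generalized Wolff energy (Corollary 3.5). -/
theorem wolff_energy_quasi_additive (n : ℕ) (p γ : ℝ)
    (hp : 1 < p) (hpn : p < n) (hγ : 0 < γ) :
    ∃ c₁ c₂ : ℝ≥0∞, 0 < c₁ ∧ c₂ < ⊤ ∧
      ∀ μ ν : Measure (EuclideanSpace ℝ (Fin n)),
        c₁ * (∫⁻ x, (wolff n p μ x) ^ γ ∂μ + ∫⁻ x, (wolff n p ν x) ^ γ ∂ν) ≤
            ∫⁻ x, (wolff n p (μ + ν) x) ^ γ ∂(μ + ν) ∧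
          ∫⁻ x, (wolff n p (μ + ν) x) ^ γ ∂(μ + ν) ≤
            c₂ * (∫⁻ x, (wolff n p μ x) ^ γ ∂μ + ∫⁻ x, (wolff n p ν x) ^ γ ∂ν) := by
  obtain ⟨N, τ, hτ, hN⟩ :=
    HasBesicovitchCovering.no_satelliteConfig (α := EuclideanSpace ℝ (Fin n))
  have hq : 0 ≤ 1 / (p - 1) := by
    have : 0 < p - 1 := by linarith
    positivity
  have h2 : ∀ s : ℝ, 0 ≤ s → (2 : ℝ≥0∞) ^ s ≠ ⊤ := fun s hs =>
    ENNReal.rpow_ne_top_of_nonneg hs (by norm_num)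
  have hD : dblC n p ^ γ ≠ ⊤ := ENNReal.rpow_ne_top_of_nonneg hγ.le
    (ENNReal.rpow_ne_top_of_nonneg hq ENNReal.ofReal_ne_top)
  set A : ℝ≥0∞ := (2 ^ (1 / (p - 1))) ^ γ * 2 ^ γ with hA
  have hAt : A ≠ ⊤ := ENNReal.mul_ne_top
    (ENNReal.rpow_ne_top_of_nonneg hγ.le (h2 _ hq)) (h2 _ hγ.le)
  set B : ℝ≥0∞ := N * dblC n p ^ γ with hB
  have hBt : B ≠ ⊤ := ENNReal.mul_ne_top (ENNReal.natCast_ne_top N) hD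
  refine ⟨1, A * (1 + 2 ^ γ * (1 + B)), one_pos, ?_, fun μ ν => ⟨?_, ?_⟩⟩
  · refine (ENNReal.mul_ne_top hAt ?_).lt_top
    exact ENNReal.add_ne_top.2 ⟨one_ne_top, ENNReal.mul_ne_top (h2 _ hγ.le)
      (ENNReal.add_ne_top.2 ⟨one_ne_top, hBt⟩)⟩
  · rw [one_mul, lintegral_add_measure]
    have h1 : μ ≤ μ + ν := Measure.le_add_right le_rfl
    have h1' : ν ≤ μ + ν := Measure.le_add_left le_rfl
    gcongr with x x
    · exact wolff_mono hp h1 x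
    · exact wolff_mono hp h1' x
  · have hpt : ∀ x, (wolff n p (μ + ν) x) ^ γ ≤
        A * ((wolff n p μ x) ^ γ + (wolff n p ν x) ^ γ) := by
      intro x
      refine (ENNReal.rpow_le_rpow (wolff_add_le hp μ ν x) hγ.le).trans ?_
      rw [ENNReal.mul_rpow_of_nonneg _ _ hγ.le, hA, mul_assoc]
      gcongr
      exact ENNReal.add_rpow_le_two_rpow_mul_rpow_add_rpow _ _ hγ.le
    have c1 := cross hp hγ hτ hN μ ν
    have c2 := cross hp hγ hτ hN ν μ
    refine (lintegral_mono hpt).trans ?_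
    rw [lintegral_const_mul' _ _ hAt,
      lintegral_add_left ((measurable_wolff n p μ).pow_const _),
      lintegral_add_measure, lintegral_add_measure, mul_assoc A]
    gcongr
    rw [← hB] at c1 c2
    set X := ∫⁻ x, (wolff n p μ x) ^ γ ∂μ
    set Y := ∫⁻ x, (wolff n p ν x) ^ γ ∂ν
    calc _ ≤ X + 2 ^ γ * (Y + B * X) + (2 ^ γ * (X + B * Y) + Y) := by gcongr
      _ = _ := by ring
end

section
/- Let $1 < p < n$, $0 < \gamma < \infty$, and set $r = n(p-1+\gamma)/(n-p)$, $\rho = p-1+\gamma$. Then for any nonnegative $f \in L^{\frac{r}{r-\gamma},\frac{\rho}{\rho-\gamma}}(\mathbb{R}^n)$, one has $\int_{\mathbb{R}^n} (\mathbf{W}_{1,p}(f\,dx))^\gamma f\, dx \leq C\, \|f\|_{L^{\frac{r}{r-\gamma},\frac{\rho}{\rho-\gamma}}(\mathbb{R}^n)}^{1+\frac{\gamma}{p-1}}$, where $C = C(n,p,\gamma)$. -/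
open MeasureTheory Metric ENNReal

/-- The decreasing rearrangement of `f` with respect to Lebesgue measure. -/
noncomputable def rearrangement {n : ℕ} (f : EuclideanSpace ℝ (Fin n) → ℝ≥0∞) (t : ℝ) : ℝ≥0∞ :=
  sInf {a : ℝ≥0∞ | volume {x | a < f x} ≤ ENNReal.ofReal t}

/-- The Lorentz `L^{r,ρ}` quasinorm (with respect to Lebesgue measure),
`‖f‖_{L^{r,ρ}} = (∫₀^∞ (t^{1/r} f^*(t))^ρ dt/t)^{1/ρ}`. -/
noncomputable def lorentzNorm {n : ℕ} (r ρ : ℝ) (f : EuclideanSpace ℝ (Fin n) → ℝ≥0∞) : ℝ≥0∞ :=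
  (∫⁻ t in Set.Ioi (0 : ℝ),
    (ENNReal.ofReal (t ^ (1 / r)) * rearrangement f t) ^ ρ / ENNReal.ofReal t) ^ (1 / ρ)


/-- dyadic powers -/
noncomputable def P2 (x : ℝ) : ℝ≥0∞ := (2 : ℝ≥0∞) ^ x

lemma P2_add (x y : ℝ) : P2 (x + y) = P2 x * P2 y :=
  ENNReal.rpow_add _ _ (by norm_num) (by norm_num)
lemma P2_zero : P2 0 = 1 := by simp [P2]
lemma P2_ne_zero (x : ℝ) : P2 x ≠ 0 := by simp [P2, ENNReal.rpow_eq_zero_iff]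
lemma P2_ne_top (x : ℝ) : P2 x ≠ ⊤ := by simp [P2, ENNReal.rpow_eq_top_iff]
lemma P2_rpow (x y : ℝ) : P2 x ^ y = P2 (x * y) := by simp [P2, ENNReal.rpow_mul]
lemma P2_mono {x y : ℝ} (h : x ≤ y) : P2 x ≤ P2 y :=
  ENNReal.rpow_le_rpow_of_exponent_le (by norm_num) h
lemma P2_ofReal (x : ℝ) : P2 x = ENNReal.ofReal ((2:ℝ) ^ x) := by
  rw [P2, ← ENNReal.ofReal_rpow_of_pos (by norm_num)]; simp
lemma P2_cancel (x : ℝ) : P2 x * P2 (-x) = 1 := by rw [← P2_add]; simp [P2_zero]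

lemma tsum_mul_rpow_le {ι : Type*} (c y : ι → ℝ≥0∞) {e : ℝ} (he : 0 < e) :
    (∑' j, c j * y j) ^ e ≤ (∑' j, c j) ^ e * ∑' j, y j ^ e := by
  set Y := ∑' j, y j ^ e with hY
  have h1 : ∀ j, y j ≤ Y ^ (1 / e) := fun j => by
    have : y j ^ e ≤ Y := ENNReal.le_tsum j
    calc y j = (y j ^ e) ^ (1 / e) := by
          rw [← ENNReal.rpow_mul, mul_one_div_cancel he.ne', ENNReal.rpow_one]
      _ ≤ _ := ENNReal.rpow_le_rpow this (by positivity)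
  calc (∑' j, c j * y j) ^ e ≤ (∑' j, c j * Y ^ (1 / e)) ^ e := by
        apply ENNReal.rpow_le_rpow _ he.le
        exact ENNReal.tsum_le_tsum fun j => mul_le_mul_right (h1 j) _
    _ = (∑' j, c j) ^ e * Y := by
        rw [ENNReal.tsum_mul_right, ENNReal.mul_rpow_of_nonneg _ _ he.le, ← ENNReal.rpow_mul,
          one_div_mul_cancel he.ne', ENNReal.rpow_one]

/-- geometric two-sided sum -/
noncomputable def KK (δ : ℝ) : ℝ≥0∞ := ∑' j : ℤ, P2 (-δ * |(j : ℝ)|)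

lemma KK_ne_top {δ : ℝ} (hδ : 0 < δ) : KK δ ≠ ⊤ := by
  have hn : ∀ (m : ℕ), P2 (-δ * (m:ℝ)) = (P2 (-δ)) ^ m := fun m => by
    rw [← P2_rpow, ENNReal.rpow_natCast]
  have hlt : P2 (-δ) < 1 := by
    have := ENNReal.rpow_lt_rpow_of_exponent_lt (x := 2) (by norm_num) (by norm_num) (neg_lt_zero.2 hδ)
    simpa [P2] using this
  have hg : ∑' m : ℕ, (P2 (-δ)) ^ m ≠ ⊤ := by
    rw [ENNReal.tsum_geometric]
    exact ENNReal.inv_ne_top.2 (tsub_pos_of_lt hlt).ne'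
  have : KK δ ≤ ∑' m : ℕ, (P2 (-δ)) ^ m + ∑' m : ℕ, (P2 (-δ)) ^ m := by
    have h2 : KK δ = ∑' m : ℕ, P2 (-δ * |((m : ℤ) : ℝ)|) + ∑' m : ℕ, P2 (-δ * |((-(m + 1 : ℤ) : ℤ) : ℝ)|) := by
      rw [KK]
      exact tsum_of_nat_of_neg_add_one ENNReal.summable ENNReal.summable
    rw [h2]
    gcongr with m m
    · rw [← hn]; simp
    · rw [← hn]; apply P2_mono
      have : |((-(m + 1 : ℤ) : ℤ) : ℝ)| = m + 1 := by
        push_cast; rw [abs_neg, abs_of_nonneg (by positivity)]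
      rw [this]; nlinarith
  exact ne_top_of_le_ne_top (ENNReal.add_ne_top.2 ⟨hg, hg⟩) this

lemma KK_shift (δ : ℝ) (k : ℤ) : ∑' j : ℤ, P2 (-δ * |(j : ℝ) - k|) = KK δ := by
  rw [KK, ← (Equiv.subRight k).tsum_eq (fun j : ℤ => P2 (-δ * |(j : ℝ)|))]
  simp

lemma KK_shift' (δ : ℝ) (k : ℤ) : ∑' j : ℤ, P2 (-δ * |(k : ℝ) - j|) = KK δ := by
  simp_rw [abs_sub_comm (k : ℝ)]
  exact KK_shift δ k

lemma conv_le (δ e : ℝ) (he : 0 < e) (y : ℤ → ℝ≥0∞) (k : ℤ) :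
    (∑' j : ℤ, P2 (-δ * |(j : ℝ) - k|) * y j) ^ e ≤
      KK (δ / 2) ^ e * ∑' j : ℤ, P2 (-(δ / 2 * e) * |(j : ℝ) - k|) * y j ^ e := by
  have := tsum_mul_rpow_le (fun j : ℤ => P2 (-(δ / 2) * |(j : ℝ) - k|))
    (fun j : ℤ => P2 (-(δ / 2) * |(j : ℝ) - k|) * y j) he
  rw [KK_shift] at this
  convert this using 4 with j j
  · rw [← mul_assoc, ← P2_add]; congr 2; ring
  · rw [ENNReal.mul_rpow_of_nonneg _ _ he.le, P2_rpow]; congr 2; ring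

lemma sum_conv (δ : ℝ) (x : ℤ → ℝ≥0∞) :
    ∑' k : ℤ, ∑' j : ℤ, P2 (-δ * |(j : ℝ) - k|) * x j = KK δ * ∑' j, x j := by
  rw [ENNReal.tsum_comm, ← ENNReal.tsum_mul_left]
  congr 1; ext j
  rw [ENNReal.tsum_mul_right, KK_shift']

/-- discrete Hardy/Young. -/
lemma sum_conv_rpow (δ e : ℝ) (he : 0 < e) (y : ℤ → ℝ≥0∞) :
    ∑' k : ℤ, (∑' j : ℤ, P2 (-δ * |(j : ℝ) - k|) * y j) ^ e ≤
      KK (δ / 2) ^ e * KK (δ / 2 * e) * ∑' j, y j ^ e := by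
  calc _ ≤ ∑' k : ℤ, KK (δ / 2) ^ e * ∑' j : ℤ, P2 (-(δ / 2 * e) * |(j : ℝ) - k|) * y j ^ e :=
        ENNReal.tsum_le_tsum fun k => conv_le δ e he y k
    _ = _ := by rw [ENNReal.tsum_mul_left, sum_conv, mul_assoc]

/-- the main discrete sum -/
lemma main_discrete (ε q γ : ℝ) (hq : 0 < q) (hγ : 0 < γ) (u : ℤ → ℝ≥0∞) :
    ∑' k : ℤ, u (k + 1) * (∑' j : ℤ, P2 (-ε * |(j : ℝ) - k|) * u (max j k) ^ q) ^ γ ≤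
      (1 + KK (ε / 2) ^ ((1 + γ * q) / q) * (2 * KK (ε / 2 * ((1 + γ * q) / q)))) *
        ∑' k, u k ^ (1 + γ * q) := by
  set s := 1 + γ * q with hs
  have hs0 : 0 < s := by positivity
  set e := s / q with he
  have he0 : 0 < e := by positivity
  have key : ∀ a b : ℝ≥0∞, a * b ^ γ ≤ a ^ s + b ^ e := by
    intro a b
    set M := max a (b ^ (1 / q))
    have h1 : a ≤ M := le_max_left _ _
    have h2 : b ≤ M ^ q := by
      calc b = (b ^ (1 / q)) ^ q := by
            rw [← ENNReal.rpow_mul, one_div_mul_cancel hq.ne', ENNReal.rpow_one]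
        _ ≤ M ^ q := ENNReal.rpow_le_rpow (le_max_right _ _) hq.le
    calc a * b ^ γ ≤ M * (M ^ q) ^ γ := by gcongr
      _ = M ^ s := by
        rw [← ENNReal.rpow_mul, hs, ENNReal.rpow_add_of_nonneg _ _ zero_le_one (by positivity),
          ENNReal.rpow_one, mul_comm q]
      _ ≤ a ^ s + b ^ e := by
        rcases max_cases a (b ^ (1 / q)) with h | h
        · simp only [M, h.1]; exact le_self_add
        · simp only [M, h.1]
          rw [← ENNReal.rpow_mul, one_div_mul_eq_div]; exact le_add_self
  calc _ ≤ ∑' k : ℤ, (u (k + 1) ^ s +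
        (∑' j : ℤ, P2 (-ε * |(j : ℝ) - k|) * u (max j k) ^ q) ^ e) :=
        ENNReal.tsum_le_tsum fun k => key _ _
    _ = ∑' k : ℤ, u k ^ s +
        ∑' k : ℤ, (∑' j : ℤ, P2 (-ε * |(j : ℝ) - k|) * u (max j k) ^ q) ^ e := by
        rw [ENNReal.tsum_add]
        congr 1
        exact (Equiv.addRight (1 : ℤ)).tsum_eq (fun k : ℤ => u k ^ s)
    _ ≤ ∑' k : ℤ, u k ^ s + ∑' k : ℤ, KK (ε / 2) ^ e *
          (∑' j : ℤ, P2 (-(ε / 2 * e) * |(j : ℝ) - k|) * u j ^ s +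
            ∑' j : ℤ, P2 (-(ε / 2 * e) * |(j : ℝ) - k|) * u k ^ s) := by
        gcongr with k
        refine (conv_le ε e he0 (fun j => u (max j k) ^ q) k).trans ?_
        gcongr
        rw [← ENNReal.tsum_add]
        gcongr with j
        rw [← mul_add, ← ENNReal.rpow_mul, he, mul_div_cancel₀ _ hq.ne']
        gcongr
        rcases max_cases j k with h | h
        · rw [h.1]; exact le_self_add
        · rw [h.1]; exact le_add_self
    _ = _ := by
        rw [ENNReal.tsum_mul_left, ENNReal.tsum_add, sum_conv]
        simp_rw [ENNReal.tsum_mul_right, KK_shift]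
        rw [ENNReal.tsum_mul_left]
        ring

lemma rearrangement_anti {n : ℕ} (g : EuclideanSpace ℝ (Fin n) → ℝ≥0∞) {s t : ℝ} (h : s ≤ t) :
    rearrangement g t ≤ rearrangement g s := by
  apply sInf_le_sInf
  intro a ha
  exact le_trans ha (ENNReal.ofReal_le_ofReal h)

lemma volume_rearrangement {n : ℕ} (g : EuclideanSpace ℝ (Fin n) → ℝ≥0∞) (t : ℝ) :
    volume {x | rearrangement g t < g x} ≤ ENNReal.ofReal t := by
  obtain ⟨u, hu, hlim, hmem⟩ := exists_seq_tendsto_sInf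
    (S := {a : ℝ≥0∞ | volume {x | a < g x} ≤ ENNReal.ofReal t}) ⟨⊤, by simp⟩ (OrderBot.bddBelow _)
  have h : {x | rearrangement g t < g x} ⊆ ⋃ n, {x | u n < g x} := by
    intro x hx
    obtain ⟨m, hm⟩ := (hlim.eventually_lt_const (show _ < g x from hx)).exists
    exact Set.mem_iUnion.2 ⟨m, hm⟩
  refine (measure_mono h).trans ?_
  have hm : Monotone fun n => {x | u n < g x} := fun i j hij x hx => (hu hij).trans_lt hx
  rw [hm.measure_iUnion]
  exact iSup_le fun i => hmem i

/-- majorant of the integral of the rearrangement over `(0, 2^k)`. -/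
noncomputable def Phi (a : ℤ → ℝ≥0∞) (k : ℤ) : ℝ≥0∞ :=
  ∑' i : ℕ, P2 ((k : ℝ) - i) * a (k - 1 - i)

lemma P2_tendsto_bot (k : ℝ) : Filter.Tendsto (fun i : ℕ => P2 (k - i)) Filter.atTop (nhds 0) := by
  have h : ∀ i : ℕ, P2 (k - i) = P2 k * (P2 (-1)) ^ i := fun i => by
    rw [sub_eq_add_neg, P2_add, ← ENNReal.rpow_natCast, P2_rpow]; simp
  simp_rw [h]
  rw [← mul_zero (P2 k)]
  apply ENNReal.Tendsto.const_mul _ (Or.inr (P2_ne_top k))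
  apply ENNReal.tendsto_pow_atTop_nhds_zero_of_lt_one
  simp only [P2, ENNReal.rpow_neg_one]
  simp [ENNReal.inv_lt_one]

lemma sigma_le_Phi {n : ℕ} (g : EuclideanSpace ℝ (Fin n) → ℝ≥0∞) (hg : Measurable g)
    (a : ℤ → ℝ≥0∞) (ha : ∀ i : ℤ, volume {x | a i < g x} ≤ P2 i) (k : ℤ)
    (A : Set (EuclideanSpace ℝ (Fin n))) (hA : volume A ≤ P2 k) :
    volume.withDensity g A ≤ Phi a k := by
  wlog hAm : MeasurableSet A generalizing A
  · exact (measure_mono (subset_toMeasurable volume A)).trans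
      (this _ (by rwa [measure_toMeasurable]) (measurableSet_toMeasurable _ _))
  set D : ℤ → Set (EuclideanSpace ℝ (Fin n)) := fun i => {x | a i < g x} with hD
  have hDm : ∀ i, MeasurableSet (D i) := fun i => measurableSet_lt measurable_const hg
  set E : ℕ → Set (EuclideanSpace ℝ (Fin n)) := fun i => if i = 0 then A else D (k - i) with hE
  have hEm : ∀ i, MeasurableSet (E i) := fun i => by
    simp only [hE]; split_ifs
    exacts [hAm, hDm _]
  have hEv : ∀ i : ℕ, volume (E i) ≤ P2 ((k : ℝ) - i) := fun i => by
    simp only [hE]; split_ifs with h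
    · simpa [h] using hA
    · have := ha (k - i); push_cast at this; exact this
  have hnull : volume (⋂ i : ℕ, D (k - 1 - i)) = 0 := by
    have : ∀ i : ℕ, volume (⋂ i : ℕ, D (k - 1 - i)) ≤ P2 (((k : ℝ) - 1) - i) := fun i => by
      refine (measure_mono (Set.iInter_subset _ i)).trans ?_
      have := ha (k - 1 - i); push_cast at this; exact this
    exact le_antisymm (ge_of_tendsto' (P2_tendsto_bot _) this) (zero_le)
  have hsub : A ⊆ (⋃ i : ℕ, E i \ D (k - 1 - i)) ∪ ⋂ i : ℕ, D (k - 1 - i) := by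
    intro x hx
    by_cases h : x ∈ ⋂ i : ℕ, D (k - 1 - i)
    · exact Or.inr h
    · left
      simp only [Set.mem_iInter, not_forall] at h
      classical
      refine Set.mem_iUnion.2 ⟨Nat.find h, ?_, Nat.find_spec h⟩
      simp only [hE]
      split_ifs with h0
      · exact hx
      · have := Nat.find_min h (m := Nat.find h - 1) (by omega)
        simp only [not_not] at this
        convert this using 2
        have h1 : 1 ≤ Nat.find h := by omega
        push_cast [h1]; ring
  calc volume.withDensity g A
      ≤ volume.withDensity g (⋃ i : ℕ, E i \ D (k - 1 - i)) +
        volume.withDensity g (⋂ i : ℕ, D (k - 1 - i)) :=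
        (measure_mono hsub).trans (measure_union_le _ _)
    _ = volume.withDensity g (⋃ i : ℕ, E i \ D (k - 1 - i)) := by
        rw [withDensity_absolutelyContinuous volume g hnull, add_zero]
    _ ≤ ∑' i : ℕ, volume.withDensity g (E i \ D (k - 1 - i)) := measure_iUnion_le _
    _ ≤ Phi a k := by
        refine ENNReal.tsum_le_tsum fun i => ?_
        have hm := (hEm i).diff (hDm (k - 1 - i))
        rw [withDensity_apply _ hm]
        calc ∫⁻ x in E i \ D (k - 1 - i), g x ≤ ∫⁻ x in E i \ D (k - 1 - i), a (k - 1 - i) := by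
              apply setLIntegral_mono' hm
              intro x hx
              exact not_lt.1 hx.2
          _ = a (k - 1 - i) * volume (E i \ D (k - 1 - i)) := by simp
          _ ≤ a (k - 1 - i) * P2 ((k : ℝ) - i) := by
              gcongr; exact (measure_mono Set.sdiff_subset).trans (hEv i)
          _ = _ := mul_comm _ _

/-- Weak type (1,1) for the maximal function of a finite measure. -/
lemma weak_type {n : ℕ} (hn : n ≠ 0) (ν : Measure (EuclideanSpace ℝ (Fin n))) (hν : ν Set.univ ≠ ⊤)
    (l : ℝ≥0∞) (hl0 : l ≠ 0) (hlt : l ≠ ⊤) :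
    l * volume {x | ∃ r : ℝ, 0 < r ∧ l * ENNReal.ofReal (r ^ n) < ν (ball x r)} ≤
      5 ^ n * volume (ball (0 : EuclideanSpace ℝ (Fin n)) 1) * ν Set.univ := by
  set Ω := {x | ∃ r : ℝ, 0 < r ∧ l * ENNReal.ofReal (r ^ n) < ν (ball x r)} with hΩ
  have hex : ∀ x : EuclideanSpace ℝ (Fin n), ∃ r : ℝ, x ∈ Ω → 0 < r ∧ l * ENNReal.ofReal (r ^ n) < ν (ball x r) := by
    intro x
    by_cases h : x ∈ Ω
    · obtain ⟨r, hr⟩ := h; exact ⟨r, fun _ => hr⟩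
    · exact ⟨0, fun h' => absurd h' h⟩
  choose r hr using hex
  set B := (ν Set.univ / l).toReal with hB
  have hbd : ∀ x ∈ Ω, r x ≤ max 1 B := by
    intro x hx
    obtain ⟨h0, h1⟩ := hr x hx
    rcases le_total (r x) 1 with h | h
    · exact h.trans (le_max_left _ _)
    · refine le_trans ?_ (le_max_right _ _)
      have h2 : r x ≤ r x ^ n := le_self_pow₀ h hn
      refine h2.trans ?_
      have h3 : ENNReal.ofReal (r x ^ n) ≤ ν Set.univ / l := by
        rw [ENNReal.le_div_iff_mul_le (Or.inl hl0) (Or.inl hlt), mul_comm]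
        exact h1.le.trans (measure_mono (Set.subset_univ _))
      rw [hB]
      exact (ENNReal.ofReal_le_iff_le_toReal (ENNReal.div_ne_top hν hl0)).1 h3
  obtain ⟨u, hu, hdisj, hcov⟩ := Vitali.exists_disjoint_subfamily_covering_enlargement_closedBall
    Ω id r (max 1 B) hbd 5 (by norm_num)
  have hcount : u.Countable := hdisj.countable_of_nonempty_interior fun x hx =>
    (nonempty_ball.2 (hr x (hu hx)).1).mono ball_subset_interior_closedBall
  have hsub : Ω ⊆ ⋃ x ∈ u, closedBall x (5 * r x) := by
    intro x hx
    obtain ⟨b, hb, hs⟩ := hcov x hx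
    exact Set.mem_biUnion hb (hs (mem_closedBall_self (hr x hx).1.le))
  set c := volume (ball (0 : EuclideanSpace ℝ (Fin n)) 1) with hc
  have := hcount.to_subtype
  have hdisj' : u.PairwiseDisjoint fun x => closedBall x (r x) := hdisj
  calc l * volume Ω ≤ l * ∑' x : u, volume (closedBall (x : EuclideanSpace ℝ (Fin n)) (5 * r x)) := by
        gcongr
        refine (measure_mono hsub).trans ?_
        exact measure_biUnion_le _ hcount _
    _ = ∑' x : u, 5 ^ n * c * (l * ENNReal.ofReal (r x ^ n)) := by
        rw [← ENNReal.tsum_mul_left]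
        congr 1; ext x
        have h0 := (hr x (hu x.2)).1
        rw [Measure.addHaar_closedBall _ _ (by positivity), finrank_euclideanSpace_fin, mul_pow,
          ENNReal.ofReal_mul (by positivity), ENNReal.ofReal_pow (by norm_num)]
        simp only [ENNReal.ofReal_ofNat]
        ring
    _ ≤ ∑' x : u, 5 ^ n * c * ν (closedBall (x : EuclideanSpace ℝ (Fin n)) (r x)) := by
        gcongr with x
        exact (hr x (hu x.2)).2.le.trans (measure_mono ball_subset_closedBall)
    _ = 5 ^ n * c * ν (⋃ x ∈ u, closedBall x (r x)) := by
        rw [ENNReal.tsum_mul_left, measure_biUnion hcount hdisj' (fun _ _ => isClosed_closedBall.measurableSet)]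
    _ ≤ _ := by gcongr; exact Set.subset_univ _

/-- The exceptional set has measure at most `2^k`. -/
lemma omega_le {n : ℕ} (hn : n ≠ 0) (g : EuclideanSpace ℝ (Fin n) → ℝ≥0∞) (hg : Measurable g)
    (a : ℤ → ℝ≥0∞) (ha : ∀ i : ℤ, volume {x | a i < g x} ≤ P2 i) (hanti : Antitone a) (k : ℤ)
    (hfin : Phi a k ≠ ⊤) :
    volume {x | ∃ r : ℝ, 0 < r ∧
      (6 ^ n * volume (ball (0 : EuclideanSpace ℝ (Fin n)) 1)) * (P2 (-k) * Phi a k) *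
        ENNReal.ofReal (r ^ n) < volume.withDensity g (ball x r)} ≤ P2 k := by
  set c := volume (ball (0 : EuclideanSpace ℝ (Fin n)) 1) with hc
  have hc0 : c ≠ 0 := (measure_ball_pos _ _ one_pos).ne'
  have hct : c ≠ ⊤ := measure_ball_lt_top.ne
  set D := {x | a k < g x} with hD
  have hDm : MeasurableSet D := measurableSet_lt measurable_const hg
  set σ := volume.withDensity g with hσ
  have hsplit : ∀ A, MeasurableSet A → σ A ≤ σ.restrict D A + a k * volume A := by
    intro A hA
    have : A ⊆ (A ∩ D) ∪ (A \ D) := by rw [Set.inter_union_sdiff]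
    refine (measure_mono this).trans ((measure_union_le _ _).trans ?_)
    rw [Measure.restrict_apply hA]
    gcongr
    rw [hσ, withDensity_apply _ (hA.diff hDm)]
    calc ∫⁻ x in A \ D, g x ≤ ∫⁻ x in A \ D, a k :=
          setLIntegral_mono' (hA.diff hDm) fun x hx => not_lt.1 hx.2
      _ = a k * volume (A \ D) := by simp
      _ ≤ _ := by gcongr; exact Set.sdiff_subset
  have hDσ : σ D ≤ Phi a k := sigma_le_Phi g hg a ha k D (ha k)
  have hak : a k ≤ P2 (-k) * Phi a k := by
    have h1 : P2 k * a (k - 1) ≤ Phi a k := by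
      have := ENNReal.le_tsum (f := fun i : ℕ => P2 ((k : ℝ) - i) * a (k - 1 - i)) 0
      simpa [Phi] using this
    calc a k ≤ a (k - 1) := hanti (by omega)
      _ = P2 (-k) * (P2 k * a (k - 1)) := by
        rw [← mul_assoc, mul_comm (P2 (-k)), P2_cancel, one_mul]
      _ ≤ _ := by gcongr
  have hn56 : (5 : ℝ≥0∞) ^ n + 1 ≤ 6 ^ n := by
    have : (5 : ℕ) ^ n < 6 ^ n := Nat.pow_lt_pow_left (by norm_num) hn
    exact_mod_cast this
  set L := P2 (-k) * Phi a k with hL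
  have hLt : L ≠ ⊤ := ENNReal.mul_ne_top (P2_ne_top _) hfin
  by_cases h0 : Phi a k = 0
  · have hL0 : L = 0 := by rw [hL, h0, mul_zero]
    have hall : ∀ x r, σ (ball x r) = 0 := by
      intro x r
      have := hsplit (ball x r) measurableSet_ball
      have h1 : a k = 0 := by simpa [hL0] using hak
      have h2 : σ.restrict D (ball x r) = 0 := by
        refine le_antisymm ?_ (zero_le)
        refine (measure_mono (Set.subset_univ _)).trans ?_
        simpa [h0] using hDσ
      simpa [h1, h2] using this
    simp [hall]
  · have hsub : {x | ∃ r : ℝ, 0 < r ∧ (6 ^ n * c) * L * ENNReal.ofReal (r ^ n) < σ (ball x r)} ⊆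
      {x | ∃ r : ℝ, 0 < r ∧ (5 ^ n * c * L) * ENNReal.ofReal (r ^ n) < σ.restrict D (ball x r)} := by
      rintro x ⟨r, hr, hx⟩
      refine ⟨r, hr, ?_⟩
      have h1 := hsplit (ball x r) measurableSet_ball
      have hv : volume (ball x r) = ENNReal.ofReal (r ^ n) * c := by
        rw [Measure.addHaar_ball_of_pos _ _ hr, finrank_euclideanSpace_fin]
      rw [hv] at h1
      by_contra hcon
      push Not at hcon
      refine absurd hx (not_lt.2 (h1.trans ?_))
      calc _ ≤ 5 ^ n * c * L * ENNReal.ofReal (r ^ n) + L * (ENNReal.ofReal (r ^ n) * c) := by gcongr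
        _ = (5 ^ n + 1) * (c * L * ENNReal.ofReal (r ^ n)) := by ring
        _ ≤ 6 ^ n * (c * L * ENNReal.ofReal (r ^ n)) := by gcongr
        _ = _ := by ring
    have hL0 : L ≠ 0 := mul_ne_zero (P2_ne_zero _) h0
    have h5 : (5 : ℝ≥0∞) ^ n * c ≠ 0 := mul_ne_zero (by simp) hc0
    have h5t : (5 : ℝ≥0∞) ^ n * c ≠ ⊤ := ENNReal.mul_ne_top (by simp) hct
    have hw := weak_type hn (σ.restrict D) (by simpa using ne_top_of_le_ne_top hfin hDσ)
      (5 ^ n * c * L) (mul_ne_zero h5 hL0) (ENNReal.mul_ne_top h5t hLt)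
    refine (measure_mono hsub).trans ?_
    have h2 : 5 ^ n * c * L * volume {x | ∃ r : ℝ, 0 < r ∧ (5 ^ n * c * L) * ENNReal.ofReal (r ^ n) < σ.restrict D (ball x r)} ≤ 5 ^ n * c * L * P2 k := by
      refine hw.trans ?_
      rw [Measure.restrict_apply_univ, mul_assoc _ L, hL, mul_right_comm (P2 _), mul_comm (P2 (-k)), P2_cancel, one_mul]
      gcongr
    exact (ENNReal.mul_le_mul_iff_right (mul_ne_zero h5 hL0) (ENNReal.mul_ne_top h5t hLt)).1 h2

lemma wolff_bound {n : ℕ} (hn : n ≠ 0) (p q α δ ε κ : ℝ) (hq : q = 1 / (p - 1)) (hp : 1 < p)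
    (hpn : p < n) (hδ : α - p / n = δ) (hε0 : 0 < ε) (hε1 : ε ≤ δ) (hε2 : ε ≤ p / n) (hκ : 0 < κ)
    (hκc : ENNReal.ofReal (κ ^ n) * 2 * volume (ball (0 : EuclideanSpace ℝ (Fin n)) 1) ≤ 1)
    (Mc : ℝ≥0∞) (σ : Measure (EuclideanSpace ℝ (Fin n))) (u Φ : ℤ → ℝ≥0∞)
    (hΦ : ∀ j : ℤ, Φ j = P2 (j * (1 - α)) * u j)
    (h1 : ∀ (j : ℤ) (A : Set (EuclideanSpace ℝ (Fin n))), volume A ≤ P2 j → σ A ≤ Φ j)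
    (x : EuclideanSpace ℝ (Fin n)) (k : ℤ)
    (h2 : ∀ r : ℝ, 0 < r → σ (ball x r) ≤ Mc * (P2 (-k) * Φ k) * ENNReal.ofReal (r ^ n)) :
    wolff n p σ x ≤ ((1 + Mc * 2 * ENNReal.ofReal (κ ^ n)) / ENNReal.ofReal (κ ^ ((n : ℝ) - p))) ^ q *
      P2 (-k * (q * δ)) * ∑' j : ℤ, P2 (-(ε * q) * |(j : ℝ) - k|) * u (max j k) ^ q := by
  have hq0 : 0 < q := by rw [hq]; exact one_div_pos.2 (by linarith)
  have hn0 : (0 : ℝ) < n := by exact_mod_cast Nat.pos_of_ne_zero hn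
  have hn1 : (1 : ℝ) ≤ n := by exact_mod_cast Nat.one_le_iff_ne_zero.2 hn
  set C1 := 1 + Mc * 2 * ENNReal.ofReal (κ ^ n) with hC1
  set c := volume (ball (0 : EuclideanSpace ℝ (Fin n)) 1) with hc
  set R : ℤ → ℝ := fun j => κ * (2 : ℝ) ^ ((j : ℝ) / n) with hR
  have hR0 : ∀ j, 0 < R j := fun j => by simp only [hR]; positivity
  have hRn : ∀ j, ENNReal.ofReal (R j ^ n) = ENNReal.ofReal (κ ^ n) * P2 j := fun j => by
    simp only [hR]
    rw [mul_pow, ENNReal.ofReal_mul (by positivity), P2_ofReal, ← Real.rpow_natCast (2 ^ _),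
      ← Real.rpow_mul (by norm_num), div_mul_cancel₀ _ hn0.ne']
  have hRp : ∀ j, ENNReal.ofReal (R j ^ ((n : ℝ) - p)) =
      ENNReal.ofReal (κ ^ ((n : ℝ) - p)) * P2 (j * (1 - p / n)) := fun j => by
    simp only [hR]
    rw [Real.mul_rpow hκ.le (by positivity), ENNReal.ofReal_mul (by positivity), P2_ofReal,
      ← Real.rpow_mul (by norm_num)]
    congr 3
    field_simp
  have hR2 : ∀ j, R (j + 1) ≤ 2 * R j := fun j => by
    have : (2 : ℝ) ^ (((j + 1 : ℤ) : ℝ) / n) ≤ 2 * (2 : ℝ) ^ ((j : ℝ) / n) := by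
      calc (2 : ℝ) ^ (((j + 1 : ℤ) : ℝ) / n) ≤ (2 : ℝ) ^ (1 + (j : ℝ) / n) := by
            apply Real.rpow_le_rpow_of_exponent_le (by norm_num)
            push_cast
            rw [add_div, add_comm]
            gcongr
            rw [div_le_one hn0]; exact hn1
        _ = _ := by rw [Real.rpow_add (by norm_num), Real.rpow_one]
    simp only [hR]; nlinarith
  have hcover : Set.Ioi (0 : ℝ) ⊆ ⋃ j : ℤ, Set.Ioc (R j) (R (j + 1)) := by
    intro r hr
    have hr' : 0 < r := hr
    obtain ⟨j, hj1, hj2⟩ := exists_mem_Ioc_zpow (x := r / κ) (y := (2 : ℝ) ^ (1 / (n : ℝ)))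
      (by positivity) (Real.one_lt_rpow (by norm_num) (by positivity))
    have hz : ∀ j : ℤ, ((2 : ℝ) ^ (1 / (n : ℝ))) ^ j = (2 : ℝ) ^ ((j : ℝ) / n) := fun j => by
      rw [← Real.rpow_intCast, ← Real.rpow_mul (by norm_num)]; congr 1; ring
    rw [hz] at hj1 hj2
    refine Set.mem_iUnion.2 ⟨j, ?_, ?_⟩
    · rw [lt_div_iff₀ hκ] at hj1; simp only [hR]; linarith
    · rw [div_le_iff₀ hκ] at hj2; simp only [hR]; linarith
  set Z : ℤ → ℝ≥0∞ := fun j => P2 (-δ * k) * (P2 (-ε * |(j : ℝ) - k|) * u (max j k)) with hZ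
  have hb : ∀ j : ℤ, ∀ r ∈ Set.Ioc (R j) (R (j + 1)),
      σ (ball x r) ≤ C1 * (P2 (j * (1 - p / n)) * Z j) := by
    intro j r hr
    have hr0 : 0 < r := (hR0 j).trans hr.1
    have hrn : ENNReal.ofReal (r ^ n) ≤ ENNReal.ofReal (κ ^ n) * P2 (j + 1) := by
      have := hRn (j + 1); push_cast at this; rw [← this]
      apply ENNReal.ofReal_le_ofReal
      gcongr
      exact hr.2
    have hP1 : P2 (j + 1) = 2 * P2 j := by rw [add_comm, P2_add]; simp [P2]
    rcases le_or_gt k j with hkj | hkj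
    · have hkj' : (k : ℝ) ≤ j := by exact_mod_cast hkj
      have hv : volume (ball x r) ≤ P2 j := by
        rw [Measure.addHaar_ball_of_pos _ _ hr0, finrank_euclideanSpace_fin]
        calc ENNReal.ofReal (r ^ n) * c ≤ ENNReal.ofReal (κ ^ n) * P2 (j + 1) * c := by gcongr
          _ = (ENNReal.ofReal (κ ^ n) * 2 * c) * P2 j := by rw [hP1]; ring
          _ ≤ 1 * P2 j := by gcongr
          _ = P2 j := one_mul _
      refine (h1 j _ hv).trans ?_
      rw [hΦ, hZ]
      simp only [max_eq_left hkj, abs_of_nonneg (sub_nonneg.2 hkj')]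
      calc P2 (j * (1 - α)) * u j ≤ P2 (j * (1 - p / n) + (-δ * k + -ε * (j - k))) * u j := by
            gcongr
            apply P2_mono
            have : α = δ + p / n := by linarith
            rw [this]
            nlinarith
        _ = 1 * (P2 (j * (1 - p / n)) * (P2 (-δ * k) * (P2 (-ε * (j - k)) * u j))) := by
            rw [P2_add, P2_add]; ring
        _ ≤ _ := by gcongr; exact le_self_add
    · have hkj' : (j : ℝ) < k := by exact_mod_cast hkj
      refine (h2 r hr0).trans ?_
      rw [hΦ, hZ]
      simp only [max_eq_right hkj.le, abs_of_neg (sub_neg.2 hkj')]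
      calc Mc * (P2 (-k) * (P2 (k * (1 - α)) * u k)) * ENNReal.ofReal (r ^ n)
          ≤ Mc * (P2 (-k) * (P2 (k * (1 - α)) * u k)) * (ENNReal.ofReal (κ ^ n) * P2 (j + 1)) := by
            gcongr
        _ = Mc * 2 * ENNReal.ofReal (κ ^ n) * (P2 (-k + (k * (1 - α) + j)) * u k) := by
            rw [hP1, P2_add, P2_add]; ring
        _ ≤ Mc * 2 * ENNReal.ofReal (κ ^ n) *
            (P2 (j * (1 - p / n) + (-δ * k + -ε * -(j - k))) * u k) := by
            gcongr
            apply P2_mono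
            have : α = δ + p / n := by linarith
            rw [this]
            nlinarith
        _ = Mc * 2 * ENNReal.ofReal (κ ^ n) *
            (P2 (j * (1 - p / n)) * (P2 (-δ * k) * (P2 (-ε * -(j - k)) * u k))) := by
            rw [P2_add, P2_add]; ring
        _ ≤ _ := by gcongr; exact le_add_self
  set Kp := ENNReal.ofReal (κ ^ ((n : ℝ) - p)) with hKp
  have hKp0 : Kp ≠ 0 := by rw [hKp]; simp; positivity
  have hKpt : Kp ≠ ⊤ := ENNReal.ofReal_ne_top
  have hpiece : ∀ j : ℤ, ∫⁻ r in Set.Ioc (R j) (R (j + 1)),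
      (σ (ball x r) / ENNReal.ofReal (r ^ ((n : ℝ) - p))) ^ (1 / (p - 1)) / ENNReal.ofReal r ≤
      (C1 / Kp) ^ q * Z j ^ q := by
    intro j
    have hRj := hR0 j
    have hRj0 : ENNReal.ofReal (R j) ≠ 0 := by simpa using hRj
    calc _ ≤ ∫⁻ r in Set.Ioc (R j) (R (j + 1)),
          ((C1 * (P2 (j * (1 - p / n)) * Z j)) / ENNReal.ofReal (R j ^ ((n : ℝ) - p))) ^ q
            / ENNReal.ofReal (R j) := by
          apply setLIntegral_mono' measurableSet_Ioc
          intro r hr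
          rw [← hq]
          have hr' := hr.1.le
          gcongr
          exact hb j r hr
      _ = ((C1 * (P2 (j * (1 - p / n)) * Z j)) / ENNReal.ofReal (R j ^ ((n : ℝ) - p))) ^ q
            / ENNReal.ofReal (R j) * ENNReal.ofReal (R (j + 1) - R j) := by simp
      _ ≤ ((C1 * (P2 (j * (1 - p / n)) * Z j)) / ENNReal.ofReal (R j ^ ((n : ℝ) - p))) ^ q
            / ENNReal.ofReal (R j) * ENNReal.ofReal (R j) := by
          gcongr
          linarith [hR2 j]
      _ = ((C1 * (P2 (j * (1 - p / n)) * Z j)) / ENNReal.ofReal (R j ^ ((n : ℝ) - p))) ^ q :=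
          ENNReal.div_mul_cancel hRj0 ENNReal.ofReal_ne_top
      _ = _ := by
          rw [← ENNReal.mul_rpow_of_nonneg _ _ hq0.le, hRp]
          congr 1
          rw [mul_left_comm, mul_comm Kp, ENNReal.mul_div_mul_left _ _ (P2_ne_zero _) (P2_ne_top _),
            ENNReal.mul_div_right_comm]
  calc wolff n p σ x ≤ ∫⁻ r in ⋃ j : ℤ, Set.Ioc (R j) (R (j + 1)),
      (σ (ball x r) / ENNReal.ofReal (r ^ ((n : ℝ) - p))) ^ (1 / (p - 1)) / ENNReal.ofReal r :=
        lintegral_mono_set hcover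
    _ ≤ ∑' j : ℤ, (C1 / Kp) ^ q * Z j ^ q :=
        (lintegral_iUnion_le _ _).trans (ENNReal.tsum_le_tsum hpiece)
    _ = _ := by
        rw [ENNReal.tsum_mul_left, mul_assoc]
        congr 1
        rw [← ENNReal.tsum_mul_left]
        congr 1; ext j
        simp only [hZ]
        rw [ENNReal.mul_rpow_of_nonneg _ _ hq0.le, ENNReal.mul_rpow_of_nonneg _ _ hq0.le, P2_rpow,
          P2_rpow]
        congr 2
        · ring_nf
        · ring_nf

lemma P2_neg_tendsto {δ : ℝ} (hδ : 0 < δ) :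
    Filter.Tendsto (fun i : ℕ => P2 (-i * δ)) Filter.atTop (nhds 0) := by
  have hlt : P2 (-δ) < 1 := by
    have := ENNReal.rpow_lt_rpow_of_exponent_lt (x := 2) (by norm_num) (by norm_num) (neg_lt_zero.2 hδ)
    simpa [P2] using this
  have h : ∀ i : ℕ, P2 (-i * δ) = (P2 (-δ)) ^ i := fun i => by
    rw [← ENNReal.rpow_natCast, P2_rpow]; congr 1; ring
  simp_rw [h]
  exact ENNReal.tendsto_pow_atTop_nhds_zero_of_lt_one hlt

lemma energy_le {n : ℕ} (g : EuclideanSpace ℝ (Fin n) → ℝ≥0∞) (hg : Measurable g)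
    (W : EuclideanSpace ℝ (Fin n) → ℝ≥0∞) (V : ℤ → Set (EuclideanSpace ℝ (Fin n)))
    (hVm : ∀ k, MeasurableSet (V k)) (hV : ∀ k : ℤ, volume (V k) ≤ P2 k)
    (Φ H : ℤ → ℝ≥0∞) (hΦ : ∀ k, volume.withDensity g (V k) ≤ Φ k)
    (hW : ∀ k, ∀ x ∉ V k, W x ≤ H k)
    (hH : Filter.Tendsto (fun i : ℕ => H i) Filter.atTop (nhds 0)) {γ : ℝ} (hγ : 0 < γ) :
    ∫⁻ x, W x ^ γ * g x ≤ ∑' k : ℤ, H k ^ γ * Φ (k + 1) := by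
  have hnull : volume (⋂ k : ℤ, V k) = 0 := by
    have : ∀ i : ℕ, volume (⋂ k : ℤ, V k) ≤ P2 (0 - i) := fun i => by
      refine (measure_mono (Set.iInter_subset _ (0 - (i : ℤ)))).trans ?_
      have := hV (0 - i); push_cast at this; exact this
    exact le_antisymm (ge_of_tendsto' (P2_tendsto_bot _) this) (zero_le)
  have hae : ∀ᵐ x ∂(volume : Measure (EuclideanSpace ℝ (Fin n))), x ∉ ⋂ k : ℤ, V k :=
    measure_eq_zero_iff_ae_notMem.1 hnull
  calc ∫⁻ x, W x ^ γ * g x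
      ≤ ∫⁻ x, ∑' k : ℤ, (V (k + 1)).indicator (fun y => H k ^ γ * g y) x := by
        apply lintegral_mono_ae
        filter_upwards [hae] with x hx
        simp only [Set.mem_iInter, not_forall] at hx
        obtain ⟨k0, hk0⟩ := hx
        by_cases hex : ∃ k, x ∉ V k ∧ x ∈ V (k + 1)
        · obtain ⟨k, hk, hk1⟩ := hex
          calc W x ^ γ * g x ≤ H k ^ γ * g x := by gcongr; exact hW k x hk
            _ = (V (k + 1)).indicator (fun y => H k ^ γ * g y) x := by
              rw [Set.indicator_of_mem hk1]
            _ ≤ _ := ENNReal.le_tsum k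
        · push Not at hex
          have hall : ∀ k, k0 ≤ k → x ∉ V k := fun k hk => Int.leInduction hk0 (fun m _ hm => hex m hm) k hk
          have : W x ≤ 0 := by
            refine ge_of_tendsto hH ?_
            filter_upwards [Filter.eventually_ge_atTop k0.toNat] with i hi
            exact hW _ x (hall _ (by omega))
          rw [le_antisymm this (zero_le), ENNReal.zero_rpow_of_pos hγ]
          simp
    _ = ∑' k : ℤ, ∫⁻ x, (V (k + 1)).indicator (fun y => H k ^ γ * g y) x :=
        lintegral_tsum fun k => ((hg.const_mul _).indicator (hVm _)).aemeasurable
    _ ≤ _ := by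
        gcongr with k
        rw [lintegral_indicator (hVm _), lintegral_const_mul _ hg]
        gcongr
        rw [← withDensity_apply _ (hVm _)]
        exact hΦ _

lemma u_sum_le (a : ℤ → ℝ≥0∞) (α s : ℝ) (hs : 0 < s) :
    ∑' k : ℤ, (P2 (k * (α - 1)) * Phi a k) ^ s ≤
      P2 s * (KK ((1 - α) / 2) ^ s * KK ((1 - α) / 2 * s)) * ∑' i : ℤ, (P2 (i * α) * a i) ^ s := by
  have h : ∀ k : ℤ, P2 (k * (α - 1)) * Phi a k ≤
      P2 1 * ∑' j : ℤ, P2 (-(1 - α) * |(j : ℝ) - k|) * (P2 (j * α) * a j) := by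
    intro k
    rw [Phi, ← ENNReal.tsum_mul_left, ← ENNReal.tsum_mul_left]
    have hinj : Function.Injective (fun i : ℕ => k - 1 - (i : ℤ)) := fun i j h => by
      simp only at h; omega
    refine le_trans (le_of_eq ?_) (ENNReal.tsum_comp_le_tsum_of_injective hinj _)
    congr 1; ext i
    have habs : |((k - 1 - (i : ℤ) : ℤ) : ℝ) - k| = i + 1 := by
      push_cast
      rw [show (k : ℝ) - 1 - i - k = -(i + 1) by ring, abs_neg, abs_of_nonneg (by positivity)]
    rw [habs]
    rw [← mul_assoc, ← mul_assoc, ← mul_assoc, ← P2_add, ← P2_add, ← P2_add]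
    congr 2
    push_cast; ring
  calc _ ≤ ∑' k : ℤ, (P2 1 * ∑' j : ℤ, P2 (-(1 - α) * |(j : ℝ) - k|) * (P2 (j * α) * a j)) ^ s :=
        ENNReal.tsum_le_tsum fun k => ENNReal.rpow_le_rpow (h k) hs.le
    _ = P2 s * ∑' k : ℤ, (∑' j : ℤ, P2 (-(1 - α) * |(j : ℝ) - k|) * (P2 (j * α) * a j)) ^ s := by
        rw [← ENNReal.tsum_mul_left]
        congr 1; ext k
        rw [ENNReal.mul_rpow_of_nonneg _ _ hs.le, P2_rpow, one_mul]
    _ ≤ _ := by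
        rw [mul_assoc (P2 s)]
        gcongr
        exact sum_conv_rpow (1 - α) s hs (fun j => P2 (j * α) * a j)

lemma w_sum_le {n : ℕ} (g : EuclideanSpace ℝ (Fin n) → ℝ≥0∞) (α s : ℝ) (hs : 0 < s) (hα : 0 < α) :
    ∑' i : ℤ, (P2 (i * α) * rearrangement g ((2 : ℝ) ^ i)) ^ s ≤ P2 (α * s + 1) *
      ∫⁻ t in Set.Ioi (0 : ℝ), (ENNReal.ofReal (t ^ α) * rearrangement g t) ^ s / ENNReal.ofReal t := by
  have hpz : ∀ i : ℤ, ENNReal.ofReal ((2 : ℝ) ^ i) = P2 i := fun i => by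
    rw [P2_ofReal, Real.rpow_intCast]
  have hmono : Monotone (fun i : ℤ => (2 : ℝ) ^ i) := fun i j h =>
    zpow_le_zpow_right₀ (by norm_num) h
  have hsub : (⋃ i : ℤ, Set.Ioc ((2 : ℝ) ^ i) ((2 : ℝ) ^ (i + 1))) ⊆ Set.Ioi 0 := by
    intro t ht
    obtain ⟨i, hi⟩ := Set.mem_iUnion.1 ht
    exact lt_trans (by positivity : (0 : ℝ) < 2 ^ i) hi.1
  have hpiece : ∀ i : ℤ, (P2 ((i + 1 : ℤ) * α) * rearrangement g ((2 : ℝ) ^ (i + 1))) ^ s ≤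
      P2 (α * s + 1) * ∫⁻ t in Set.Ioc ((2 : ℝ) ^ i) ((2 : ℝ) ^ (i + 1)),
        (ENNReal.ofReal (t ^ α) * rearrangement g t) ^ s / ENNReal.ofReal t := by
    intro i
    have h1 : ∫⁻ t in Set.Ioc ((2 : ℝ) ^ i) ((2 : ℝ) ^ (i + 1)),
        (P2 (i * α) * rearrangement g ((2 : ℝ) ^ (i + 1))) ^ s / P2 (i + 1) ≤
        ∫⁻ t in Set.Ioc ((2 : ℝ) ^ i) ((2 : ℝ) ^ (i + 1)),
        (ENNReal.ofReal (t ^ α) * rearrangement g t) ^ s / ENNReal.ofReal t := by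
      apply setLIntegral_mono' measurableSet_Ioc
      intro t ht
      have e1 : P2 (i * α) ≤ ENNReal.ofReal (t ^ α) := by
        rw [P2_ofReal, Real.rpow_mul (by norm_num), Real.rpow_intCast]
        apply ENNReal.ofReal_le_ofReal
        have := ht.1.le
        gcongr
      have e2 : ENNReal.ofReal t ≤ P2 (i + 1) := by
        have := hpz (i + 1); push_cast at this; rw [← this]
        exact ENNReal.ofReal_le_ofReal ht.2
      have e3 := rearrangement_anti g ht.2
      gcongr
    refine le_trans (le_of_eq ?_) (mul_le_mul_right h1 _)
    rw [setLIntegral_const, Real.volume_Ioc]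
    have : (2 : ℝ) ^ (i + 1) - 2 ^ i = 2 ^ i := by rw [zpow_add_one₀ (by norm_num)]; ring
    rw [this, hpz, ENNReal.mul_rpow_of_nonneg _ _ hs.le, ENNReal.mul_rpow_of_nonneg _ _ hs.le,
      P2_rpow, P2_rpow, div_eq_mul_inv]
    have hinv : (P2 (i + 1))⁻¹ = P2 (-(i + 1)) := by
      simp [P2, ← ENNReal.rpow_neg]
    rw [hinv]
    have : P2 (((i + 1 : ℤ) : ℝ) * α * s) = P2 (α * s + 1) * P2 (i * α * s) * P2 (-(i + 1)) * P2 i := by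
      rw [← P2_add, ← P2_add, ← P2_add]; congr 1; push_cast; ring
    rw [this]; ring
  calc _ = ∑' i : ℤ, (P2 ((i + 1 : ℤ) * α) * rearrangement g ((2 : ℝ) ^ (i + 1))) ^ s :=
        ((Equiv.addRight (1 : ℤ)).tsum_eq
          (fun i : ℤ => (P2 (i * α) * rearrangement g ((2 : ℝ) ^ i)) ^ s)).symm
    _ ≤ ∑' i : ℤ, P2 (α * s + 1) * ∫⁻ t in Set.Ioc ((2 : ℝ) ^ i) ((2 : ℝ) ^ (i + 1)),
        (ENNReal.ofReal (t ^ α) * rearrangement g t) ^ s / ENNReal.ofReal t :=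
        ENNReal.tsum_le_tsum hpiece
    _ = P2 (α * s + 1) * ∫⁻ t in ⋃ i : ℤ, Set.Ioc ((2 : ℝ) ^ i) ((2 : ℝ) ^ (i + 1)),
        (ENNReal.ofReal (t ^ α) * rearrangement g t) ^ s / ENNReal.ofReal t := by
        rw [ENNReal.tsum_mul_left, lintegral_iUnion (fun _ => measurableSet_Ioc)]
        exact hmono.pairwise_disjoint_on_Ioc_succ
    _ ≤ _ := by gcongr

/-- The inequality (3.4): `∫ (W_{1,p}(f dx))^γ f dx ≤ C ‖f‖_{L^{r/(r-γ),ρ/(ρ-γ)}}^{1+γ/(p-1)}`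
where `r = n(p-1+γ)/(n-p)` and `ρ = p-1+γ`. -/
theorem wolff_energy_of_density (n : ℕ) (p γ : ℝ) (hp : 1 < p) (hpn : p < n) (hγ : 0 < γ) :
    ∃ C : ℝ≥0∞, 0 < C ∧ C < ⊤ ∧
      ∀ f : EuclideanSpace ℝ (Fin n) → ℝ, Measurable f → (∀ x, 0 ≤ f x) →
        (letI r : ℝ := (n : ℝ) * (p - 1 + γ) / ((n : ℝ) - p)
         letI ρ : ℝ := p - 1 + γ
         lorentzNorm (r / (r - γ)) (ρ / (ρ - γ)) (fun x => ENNReal.ofReal (f x)) < ⊤) →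
        (letI r : ℝ := (n : ℝ) * (p - 1 + γ) / ((n : ℝ) - p)
         letI ρ : ℝ := p - 1 + γ
         ∫⁻ x, (wolff n p (volume.withDensity (fun y => ENNReal.ofReal (f y))) x) ^ γ *
             ENNReal.ofReal (f x) ≤
           C * (lorentzNorm (r / (r - γ)) (ρ / (ρ - γ))
                  (fun x => ENNReal.ofReal (f x))) ^ (1 + γ / (p - 1))) := by
  have hn : n ≠ 0 := by rintro rfl; norm_num at hpn; linarith
  have hn0 : (0 : ℝ) < n := by linarith
  set q : ℝ := 1 / (p - 1) with hq
  have hp1 : 0 < p - 1 := by linarith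
  have hq0 : 0 < q := by positivity
  have hnp : 0 < (n : ℝ) - p := by linarith
  set s : ℝ := 1 + γ * q with hs
  have hs0 : 0 < s := by positivity
  set α : ℝ := 1 - γ * ((n : ℝ) - p) / (n * (p - 1 + γ)) with hα
  set δ : ℝ := α - p / n with hδ
  have hδq : 1 - α = γ * q * δ := by
    rw [hδ, hα, hq]; field_simp; ring
  have hδ0 : 0 < δ := by
    have : δ = ((n : ℝ) - p) * (p - 1) / (n * (p - 1 + γ)) := by
      rw [hδ, hα]; field_simp; ring
    rw [this]; positivity
  have hα1 : 0 < 1 - α := by rw [hδq]; positivity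
  have hα0 : 0 < α := by
    have : 0 < p / n := by positivity
    linarith
  set ε : ℝ := min δ (p / n) with hε
  have hε0 : 0 < ε := lt_min hδ0 (by positivity)
  set c := volume (ball (0 : EuclideanSpace ℝ (Fin n)) 1) with hc
  have hc0 : c ≠ 0 := (measure_ball_pos _ _ one_pos).ne'
  have hct : c ≠ ⊤ := measure_ball_lt_top.ne
  obtain ⟨κ, hκ, hκc⟩ : ∃ κ : ℝ, 0 < κ ∧ ENNReal.ofReal (κ ^ n) * 2 * c ≤ 1 := by
    have hcp : 0 < c.toReal := ENNReal.toReal_pos hc0 hct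
    refine ⟨(1 / (2 * c.toReal)) ^ (1 / (n : ℝ)), by positivity, ?_⟩
    rw [← Real.rpow_natCast, ← Real.rpow_mul (by positivity), one_div_mul_cancel hn0.ne', Real.rpow_one]
    have : c = ENNReal.ofReal c.toReal := (ENNReal.ofReal_toReal hct).symm
    nth_rewrite 2 [this]
    rw [show (2 : ℝ≥0∞) = ENNReal.ofReal 2 by simp, ← ENNReal.ofReal_mul (by positivity),
      ← ENNReal.ofReal_mul (by positivity)]
    rw [show 1 / (2 * c.toReal) * 2 * c.toReal = 1 by field_simp]
    simp
  set Mc : ℝ≥0∞ := 6 ^ n * c with hMc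
  have hMct : Mc ≠ ⊤ := ENNReal.mul_ne_top (by simp) hct
  set C0 : ℝ≥0∞ := ((1 + Mc * 2 * ENNReal.ofReal (κ ^ n)) / ENNReal.ofReal (κ ^ ((n : ℝ) - p))) ^ q
    with hC0
  have hC0t : C0 ≠ ⊤ := by
    apply ENNReal.rpow_ne_top_of_nonneg hq0.le
    apply ENNReal.div_ne_top
    · exact ENNReal.add_ne_top.2 ⟨by simp, ENNReal.mul_ne_top (ENNReal.mul_ne_top hMct (by simp)) (by simp)⟩
    · simp; positivity
  set C2 : ℝ≥0∞ := 1 + KK (ε * q / 2) ^ ((1 + γ * q) / q) * (2 * KK (ε * q / 2 * ((1 + γ * q) / q)))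
    with hC2
  have hC2t : C2 ≠ ⊤ := by
    refine ENNReal.add_ne_top.2 ⟨by simp, ENNReal.mul_ne_top ?_ (ENNReal.mul_ne_top (by simp) ?_)⟩
    · exact ENNReal.rpow_ne_top_of_nonneg (by positivity) (KK_ne_top (by positivity))
    · exact KK_ne_top (by positivity)
  set C3 : ℝ≥0∞ := P2 s * (KK ((1 - α) / 2) ^ s * KK ((1 - α) / 2 * s)) with hC3
  have hC3t : C3 ≠ ⊤ := by
    refine ENNReal.mul_ne_top (P2_ne_top _) (ENNReal.mul_ne_top ?_ (KK_ne_top (by positivity)))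
    exact ENNReal.rpow_ne_top_of_nonneg (by positivity) (KK_ne_top (by positivity))
  set C4 : ℝ≥0∞ := C3 * P2 (α * s + 1) with hC4
  have hC4t : C4 ≠ ⊤ := ENNReal.mul_ne_top hC3t (P2_ne_top _)
  refine ⟨1 + C0 ^ γ * P2 (1 - α) * C2 * C4, by positivity, ?_, ?_⟩
  · rw [lt_top_iff_ne_top]
    exact ENNReal.add_ne_top.2 ⟨by simp, ENNReal.mul_ne_top (ENNReal.mul_ne_top (ENNReal.mul_ne_top
      (ENNReal.rpow_ne_top_of_nonneg hγ.le hC0t) (P2_ne_top _)) hC2t) hC4t⟩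
  intro f hf hf0
  have e1 : 1 / ((n : ℝ) * (p - 1 + γ) / ((n : ℝ) - p) / ((n : ℝ) * (p - 1 + γ) / ((n : ℝ) - p) - γ)) = α := by
    rw [hα, one_div_div]
    field_simp
  have e2 : (p - 1 + γ) / (p - 1 + γ - γ) = s := by
    rw [hs, hq, add_sub_cancel_right]; field_simp
  have e3 : 1 + γ / (p - 1) = s := by rw [hs, hq]; ring
  set g : EuclideanSpace ℝ (Fin n) → ℝ≥0∞ := fun x => ENNReal.ofReal (f x) with hg
  have hgm : Measurable g := hf.ennreal_ofReal
  simp only [lorentzNorm]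
  rw [e1, e2, e3]
  set I : ℝ≥0∞ := ∫⁻ t in Set.Ioi (0 : ℝ),
    (ENNReal.ofReal (t ^ α) * rearrangement g t) ^ s / ENNReal.ofReal t with hI
  intro hfin
  rw [← ENNReal.rpow_mul I, one_div_mul_cancel hs0.ne', ENNReal.rpow_one]
  have hIt : I ≠ ⊤ := by
    intro h
    rw [h, ENNReal.top_rpow_of_pos (by positivity)] at hfin
    exact lt_irrefl _ hfin
  set a : ℤ → ℝ≥0∞ := fun i => rearrangement g ((2 : ℝ) ^ i) with ha
  have hanti : Antitone a := fun i j h =>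
    rearrangement_anti g (zpow_le_zpow_right₀ (by norm_num) h)
  have haD : ∀ i : ℤ, volume {x | a i < g x} ≤ P2 i := fun i => by
    rw [P2_ofReal, Real.rpow_intCast]
    exact volume_rearrangement g _
  set u : ℤ → ℝ≥0∞ := fun k => P2 (k * (α - 1)) * Phi a k with hu
  have hΦu : ∀ k : ℤ, Phi a k = P2 (k * (1 - α)) * u k := fun k => by
    simp only [hu]
    rw [← mul_assoc, ← P2_add, show (k : ℝ) * (1 - α) + k * (α - 1) = 0 by ring, P2_zero, one_mul]
  set T : ℝ≥0∞ := ∑' k : ℤ, u k ^ s with hT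
  have hTI : T ≤ C4 * I := by
    refine (u_sum_le a α s hs0).trans ?_
    rw [hC4, mul_assoc C3]
    gcongr
    exact w_sum_le g α s hs0 hα0
  have hTt : T ≠ ⊤ := ne_top_of_le_ne_top (ENNReal.mul_ne_top hC4t hIt) hTI
  have huT : ∀ k, u k ≤ T ^ (1 / s) := fun k => by
    have : u k ^ s ≤ T := ENNReal.le_tsum k
    calc u k = (u k ^ s) ^ (1 / s) := by
          rw [← ENNReal.rpow_mul, mul_one_div_cancel hs0.ne', ENNReal.rpow_one]
      _ ≤ _ := ENNReal.rpow_le_rpow this (by positivity)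
  have hTs : T ^ (1 / s) ≠ ⊤ := ENNReal.rpow_ne_top_of_nonneg (by positivity) hTt
  have hΦt : ∀ k, Phi a k ≠ ⊤ := fun k => by
    rw [hΦu]
    exact ENNReal.mul_ne_top (P2_ne_top _) (ne_top_of_le_ne_top hTs (huT k))
  set σ := volume.withDensity g with hσ
  set Ω : ℤ → Set (EuclideanSpace ℝ (Fin n)) := fun k => {x | ∃ r : ℝ, 0 < r ∧
      Mc * (P2 (-k) * Phi a k) * ENNReal.ofReal (r ^ n) < σ (ball x r)} with hΩ
  have hΩv : ∀ k, volume (Ω k) ≤ P2 k := fun k => omega_le hn g hgm a haD hanti k (hΦt k)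
  set X : ℤ → ℝ≥0∞ := fun k => ∑' j : ℤ, P2 (-(ε * q) * |(j : ℝ) - k|) * u (max j k) ^ q with hX
  set H : ℤ → ℝ≥0∞ := fun k => C0 * P2 (-k * (q * δ)) * X k with hH
  have hWH : ∀ k, ∀ x ∉ toMeasurable volume (Ω k), wolff n p σ x ≤ H k := by
    intro k x hx
    have hx' : x ∉ Ω k := fun h => hx (subset_toMeasurable _ _ h)
    refine wolff_bound hn p q α δ ε κ hq hp hpn hδ.symm hε0 (min_le_left _ _) (min_le_right _ _) hκ hκc
      Mc σ u (Phi a) hΦu (fun j A hA => sigma_le_Phi g hgm a haD j A hA) x k ?_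
    intro r hr
    by_contra hcon
    exact hx' ⟨r, hr, not_le.1 hcon⟩
  have hHlim : Filter.Tendsto (fun i : ℕ => H i) Filter.atTop (nhds 0) := by
    set B : ℝ≥0∞ := KK (ε * q) * (T ^ (1 / s)) ^ q with hB
    have hBt : B ≠ ⊤ := ENNReal.mul_ne_top (KK_ne_top (by positivity))
      (ENNReal.rpow_ne_top_of_nonneg hq0.le hTs)
    have hXB : ∀ k, X k ≤ B := fun k => by
      rw [hB, ← KK_shift _ k, ← ENNReal.tsum_mul_right]
      simp only [hX]
      gcongr
      exact huT _
    have hlim := P2_neg_tendsto (δ := q * δ) (by positivity)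
    have hlim2 : Filter.Tendsto (fun i : ℕ => (C0 * B) * P2 (-i * (q * δ))) Filter.atTop (nhds 0) := by
      have := ENNReal.Tendsto.const_mul hlim (Or.inr (ENNReal.mul_ne_top hC0t hBt))
      rwa [mul_zero] at this
    refine tendsto_of_tendsto_of_tendsto_of_le_of_le tendsto_const_nhds hlim2 (fun _ => zero_le) ?_
    intro i
    simp only [hH]
    calc _ ≤ C0 * P2 (-((i : ℤ) : ℝ) * (q * δ)) * B := by gcongr; exact hXB _
      _ = _ := by push_cast; ring
  have hE := energy_le g hgm (wolff n p σ) (fun k => toMeasurable volume (Ω k))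
    (fun k => measurableSet_toMeasurable _ _) (fun k => by rw [measure_toMeasurable]; exact hΩv k)
    (Phi a) H (fun k => sigma_le_Phi g hgm a haD k _ (by rw [measure_toMeasurable]; exact hΩv k))
    hWH hHlim hγ
  refine hE.trans ?_
  have hterm : ∀ k : ℤ, H k ^ γ * Phi a (k + 1) = C0 ^ γ * P2 (1 - α) * (u (k + 1) * X k ^ γ) := by
    intro k
    rw [hΦu]
    simp only [hH]
    rw [ENNReal.mul_rpow_of_nonneg _ _ hγ.le, ENNReal.mul_rpow_of_nonneg _ _ hγ.le, P2_rpow]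
    have : P2 (-k * (q * δ) * γ) * P2 (((k + 1 : ℤ) : ℝ) * (1 - α)) = P2 (1 - α) := by
      rw [← P2_add]; congr 1; push_cast; rw [hδq]; ring
    rw [← this]; ring
  simp_rw [hterm]
  rw [ENNReal.tsum_mul_left]
  calc C0 ^ γ * P2 (1 - α) * ∑' k : ℤ, u (k + 1) * X k ^ γ
      ≤ C0 ^ γ * P2 (1 - α) * (C2 * (C4 * I)) := by
        gcongr
        refine (main_discrete (ε * q) q γ hq0 hγ u).trans ?_
        gcongr
    _ = (C0 ^ γ * P2 (1 - α) * C2 * C4) * I := by ring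
    _ ≤ _ := by gcongr; exact le_add_self
end
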